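/- arXiv:2412.14615 — 4 statements merged into one kernel-verified Lean document; each statement's English description precedes it below -/
import Mathlib

section
/- Let q be a prime power, let r > h ≥ 1 be integers, set g := gcd(r,h), and let ε_1, …, ε_{r−1} be integers such that q^{h−i} divides ε_i for all 1 ≤ i ≤ h−1 and Σ_{i=1}^{r−1} ε_i·[i]_q ≡ 0 (mod [g]_q). Then there exists σ ∈ ℕ such that σ[r] − Σ_{i=1}^{r−1} ε_i[i] is h-partitionable over F_q. -/
open scoped Classical

noncomputable section

/-- `[i]_q = 1 + q + ⋯ + q^(i-1)`, with `[0]_q = 0`. -/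
def gNum (q i : ℕ) : ℕ := ∑ j ∈ Finset.range i, q ^ j

/-- The number of elements of the multiset `S` of subspaces that contain the subspace `P`,
counted with multiplicity. -/
def mult {F V : Type*} [Field F] [AddCommGroup V] [Module F V]
    (S : Multiset (Submodule F V)) (P : Submodule F V) : ℕ :=
  Multiset.countP (fun W => P ≤ W) S

/-- `σ[r] − Σ_{i=1}^{r-1} ε_i [i]` is `h`-partitionable over `F`: there are a chain of
subspaces `C 1 ≤ ⋯ ≤ C (r-1)` of `F^r` with `dim (C i) = i` and a multiset `S` of
`h`-dimensional subspaces of `F^r` such that every point `P` (i.e. one-dimensional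
subspace) is contained in exactly `σ − Σ_{i : P ≤ C i} ε_i` members of `S`. -/
def IsHPartitionable (F : Type*) [Field F] [Fintype F] (r h σ : ℕ) (ε : ℕ → ℤ) : Prop :=
  ∃ (C : ℕ → Submodule F (Fin r → F)) (S : Multiset (Submodule F (Fin r → F))),
    (∀ i ∈ Finset.Icc 1 (r - 1), Module.finrank F (C i) = i) ∧
    (∀ i j : ℕ, 1 ≤ i → i ≤ j → j ≤ r - 1 → C i ≤ C j) ∧
    (∀ W ∈ S, Module.finrank F W = h) ∧
    (∀ P : Submodule F (Fin r → F), Module.finrank F P = 1 →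
      (mult S P : ℤ) = (σ : ℤ) - ∑ i ∈ Finset.Icc 1 (r - 1), (if P ≤ C i then ε i else 0))

open scoped LinearAlgebra.Projectivization

universe u v

namespace HP

variable {F : Type u} {V : Type v} [Field F] [AddCommGroup V] [Module F V]

lemma exists_between [FiniteDimensional F V] (T U : Submodule F V) (hTU : T ≤ U) (k : ℕ)
    (h1 : Module.finrank F T ≤ k) (h2 : k ≤ Module.finrank F U) :
    ∃ W : Submodule F V, T ≤ W ∧ W ≤ U ∧ Module.finrank F W = k := by
  induction k, h1 using Nat.le_induction with
  | base => exact ⟨T, le_rfl, hTU, rfl⟩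
  | succ k hk ih =>
    obtain ⟨W, hTW, hWU, hW⟩ := ih (by omega)
    have hlt : W < U := by
      refine lt_of_le_of_ne hWU ?_
      rintro rfl
      omega
    obtain ⟨v, hvU, hvW⟩ := SetLike.exists_of_lt hlt
    refine ⟨W ⊔ Submodule.span F {v}, hTW.trans le_sup_left, sup_le hWU (by simpa using hvU), ?_⟩
    have hv0 : v ≠ 0 := by rintro rfl; exact hvW W.zero_mem
    have h := Submodule.finrank_sup_add_finrank_inf_eq W (Submodule.span F {v})
    have hinf : W ⊓ Submodule.span F {v} = ⊥ := by
      rw [← disjoint_iff]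
      exact ((Submodule.disjoint_span_singleton' hv0).2 hvW)
    rw [hinf, finrank_bot, finrank_span_singleton hv0] at h
    omega

lemma exists_equiv [FiniteDimensional F V] (v w : V) (hv : v ≠ 0) (hw : w ≠ 0) :
    ∃ g : V ≃ₗ[F] V, g v = w := by
  obtain ⟨g, hg⟩ := Submodule.exists_linearEquiv_restrict_eq
    ((LinearEquiv.toSpanNonzeroSingleton F V v hv).symm ≪≫ₗ
      (LinearEquiv.toSpanNonzeroSingleton F V w hw))
  refine ⟨g, ?_⟩
  have := hg ⟨v, Submodule.mem_span_singleton_self v⟩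
  rw [← this, LinearEquiv.trans_apply]
  have h1 : (LinearEquiv.toSpanNonzeroSingleton F V v hv).symm
      ⟨v, Submodule.mem_span_singleton_self v⟩ = 1 := by
    rw [LinearEquiv.symm_apply_eq]
    apply Subtype.ext
    simp
  rw [h1]
  simp

/-- number of projective points inside a subspace -/
lemma card_points [Fintype F] [FiniteDimensional F V] (K : Submodule F V) (n : ℕ)
    (hK : Module.finrank F K = n) :
    Nat.card {p : ℙ F V // p.rep ∈ K} = gNum (Fintype.card F) n := by
  have h := Projectivization.card_of_finrank F K hK
  rw [Nat.card_eq_fintype_card (α := F)] at h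
  unfold gNum
  rw [← h]
  symm
  refine Nat.card_congr (Equiv.ofBijective
    (fun p : ℙ F K => (⟨Projectivization.map K.subtype K.injective_subtype p, ?_⟩ :
      {p : ℙ F V // p.rep ∈ K})) ⟨?_, ?_⟩)
  · induction p using Projectivization.ind with
    | h v hv =>
      rw [Projectivization.map_mk]
      obtain ⟨a, ha⟩ := Projectivization.exists_smul_eq_mk_rep F (K.subtype v) (by simpa using hv)
      rw [← ha]
      exact K.smul_mem _ v.2
  · intro p p' hp
    exact Projectivization.map_injective _ K.injective_subtype (congrArg Subtype.val hp)
  · rintro ⟨p, hp⟩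
    refine ⟨Projectivization.mk F (⟨p.rep, hp⟩ : K) (by
      intro h
      exact p.rep_nonzero (congrArg Subtype.val h)), ?_⟩
    apply Subtype.ext
    simp [Projectivization.map_mk, Projectivization.mk_rep]

lemma card_ker [Fintype F] [FiniteDimensional F V] (d : ℕ) (hV : Module.finrank F V = d + 1)
    (f : V →ₗ[F] F) (hf : f ≠ 0) :
    Nat.card {p : ℙ F V // f p.rep = 0} = gNum (Fintype.card F) d := by
  have h1 : Module.finrank F (LinearMap.ker f) + 1 = Module.finrank F V :=
    Module.Dual.finrank_ker_add_one_of_ne_zero (f := f) hf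
  have h2 := card_points (LinearMap.ker f) d (by omega)
  simpa only [LinearMap.mem_ker] using h2

def chi (W : Submodule F V) (v : {v : V // v ≠ 0}) : ℤ := if v.1 ∈ W then 1 else 0

lemma gNum_succ (q n : ℕ) : gNum q (n + 1) = gNum q n + q ^ n := by
  simp [gNum, Finset.sum_range_succ]

lemma gNum_succ' (q n : ℕ) : gNum q (n + 1) = 1 + q * gNum q n := by
  induction n with
  | zero => simp [gNum]
  | succ n ih =>
    rw [gNum_succ, ih]
    have := gNum_succ q n
    rw [ih] at this
    calc 1 + q * gNum q n + q ^ (n + 1) = 1 + q * (gNum q n + q ^ n) := by ring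
      _ = _ := by rw [← this]

lemma hyperplanes [Fintype F] [FiniteDimensional F V] (T U : Submodule F V) (hTU : T ≤ U)
    (i d : ℕ) (hT : Module.finrank F T = i) (hU : Module.finrank F U = i + d + 1) :
    ∃ (ι : Type (max u v)) (_ : Fintype ι) (H : ι → Submodule F V),
      Fintype.card ι = gNum (Fintype.card F) (d + 1) ∧
      (∀ j, Module.finrank F (H j) = i + d) ∧
      ∑ j, chi (H j) = (gNum (Fintype.card F) d : ℤ) • chi U
        + ((Fintype.card F : ℤ) ^ d) • chi T := by
  let T' : Submodule F U := T.comap U.subtype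
  have hT' : Module.finrank F T' = i := by
    rw [← hT]
    exact (Submodule.comapSubtypeEquivOfLe hTU).finrank_eq
  let D : Submodule F (U →ₗ[F] F) := T'.dualAnnihilator
  have hD : Module.finrank F D = d + 1 := by
    have := Subspace.finrank_add_finrank_dualAnnihilator_eq T'
    change _ + Module.finrank F D = _ at this
    omega
  have : Finite F := inferInstance
  have : Finite D := Module.finite_of_finite F
  let _ : Fintype (ℙ F D) := Fintype.ofFinite _
  refine ⟨ℙ F D, inferInstance, fun p => (LinearMap.ker (p.rep : U →ₗ[F] F)).map U.subtype,
    ?_, ?_, ?_⟩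
  · rw [← Nat.card_eq_fintype_card, Projectivization.card_of_finrank F D hD,
      Nat.card_eq_fintype_card]
    rfl
  · intro p
    rw [Submodule.finrank_map_subtype_eq]
    have := Module.Dual.finrank_ker_add_one_of_ne_zero (f := (p.rep : U →ₗ[F] F))
      (by simpa using p.rep_nonzero)
    omega
  · funext v
    simp only [Finset.sum_apply, Pi.add_apply, Pi.smul_apply, smul_eq_mul]
    obtain ⟨v, hv⟩ := v
    by_cases hvU : v ∈ U
    · have key : ∀ p : ℙ F D, chi ((LinearMap.ker (p.rep : U →ₗ[F] F)).map U.subtype) ⟨v, hv⟩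
          = if (p.rep : U →ₗ[F] F) ⟨v, hvU⟩ = 0 then 1 else 0 := by
        intro p
        unfold chi
        congr 1
        simp [hvU]
      simp only [key]
      rw [Finset.sum_boole]
      by_cases hvT : v ∈ T
      · have hall : ∀ p : ℙ F D, (p.rep : U →ₗ[F] F) ⟨v, hvU⟩ = 0 := by
          intro p
          have := p.rep.2
          rw [Submodule.mem_dualAnnihilator] at this
          exact this _ hvT
        simp only [hall, Finset.filter_true, Finset.card_univ]
        rw [← Nat.card_eq_fintype_card, Projectivization.card_of_finrank F D hD,
          Nat.card_eq_fintype_card]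
        have := gNum_succ (Fintype.card F) d
        unfold gNum at this
        rw [this]
        simp [chi, hvU, hvT, gNum]
      · let ev : D →ₗ[F] F := (LinearMap.applyₗ (R := F) (⟨v, hvU⟩ : U)).comp D.subtype
        have hev : ev ≠ 0 := by
          obtain ⟨f, hf1, hf2⟩ := Submodule.exists_dual_map_eq_bot_of_notMem
            (p := T') (x := ⟨v, hvU⟩) hvT inferInstance
          intro h0
          apply hf1
          have hfD : f ∈ D := by
            rw [Submodule.mem_dualAnnihilator]
            intro w hw
            have : f w ∈ T'.map f := Submodule.mem_map_of_mem hw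
            rwa [hf2, Submodule.mem_bot] at this
          exact LinearMap.congr_fun h0 ⟨f, hfD⟩
        have hc : Nat.card {p : ℙ F D // ev p.rep = 0} = gNum (Fintype.card F) d := by
          apply card_ker (F := F) (V := D) d hD ev
          exact hev
        rw [Nat.card_eq_fintype_card, Fintype.card_subtype] at hc
        have hc' : (Finset.univ.filter fun p : ℙ F D =>
            (p.rep : U →ₗ[F] F) ⟨v, hvU⟩ = 0).card = gNum (Fintype.card F) d := hc
        rw [hc']
        simp [chi, hvU, hvT]
    · have hvT : v ∉ T := fun h => hvU (hTU h)
      simp [chi, hvU, hvT]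

section algebra

variable [Fintype F] [FiniteDimensional F V]
variable {A : Type*} [AddCommGroup A] (π : ({v : V // v ≠ 0} → ℤ) →+ A)

local notation "qq" => Fintype.card F

lemma chi_bot : chi (⊥ : Submodule F V) = 0 := by
  funext v
  simp [chi, v.2]

lemma step1 (h : ℕ) (hπ : ∀ W : Submodule F V, Module.finrank F W = h → π (chi W) = 0)
    (T U : Submodule F V) (hTU : T ≤ U) (i d : ℕ) (hT : Module.finrank F T = i)
    (hid : i + d = h) (hU : Module.finrank F U = h + 1) :
    (gNum qq d : ℤ) • π (chi U) + ((qq : ℤ) ^ d) • π (chi T) = 0 := by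
  obtain ⟨ι, _, H, -, h2, h3⟩ := hyperplanes T U hTU i d hT (by omega)
  have := congrArg π h3
  rw [map_sum, map_add, map_zsmul, map_zsmul] at this
  rw [← this]
  exact Finset.sum_eq_zero fun j _ => hπ _ ((h2 j).trans hid)

lemma step0 (h : ℕ) (hπ : ∀ W : Submodule F V, Module.finrank F W = h → π (chi W) = 0)
    (U : Submodule F V) (hU : Module.finrank F U = h + 1) :
    (gNum qq h : ℤ) • π (chi U) = 0 := by
  have := step1 π h hπ ⊥ U bot_le 0 h (by simp) (by omega) hU
  simpa [chi_bot] using this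

lemma step2 (h : ℕ) (hh : 1 ≤ h)
    (hπ : ∀ W : Submodule F V, Module.finrank F W = h → π (chi W) = 0)
    (P U : Submodule F V) (hPU : P ≤ U) (hP : Module.finrank F P = 1)
    (hU : Module.finrank F U = h + 1) :
    π (chi U) = ((qq : ℤ) ^ h) • π (chi P) := by
  obtain ⟨k, rfl⟩ : ∃ k, h = k + 1 := ⟨h - 1, by omega⟩
  have h0 := step0 π _ hπ U hU
  have h1 := step1 π _ hπ P U hPU 1 k hP (by omega) hU
  rw [gNum_succ'] at h0
  have h2 := congrArg (fun x => (qq : ℤ) • x) h1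
  simp only [smul_add, smul_smul, smul_zero] at h2
  push_cast at h0
  rw [add_smul, one_smul] at h0
  rw [← pow_succ'] at h2
  rw [eq_neg_of_add_eq_zero_left h0, eq_neg_of_add_eq_zero_right h2]

lemma step3 (h : ℕ) (hh : 1 ≤ h) (hr : h < Module.finrank F V)
    (hπ : ∀ W : Submodule F V, Module.finrank F W = h → π (chi W) = 0)
    (U U' : Submodule F V) (hU : Module.finrank F U = h + 1) (hU' : Module.finrank F U' = h + 1) :
    π (chi U) = π (chi U') := by
  obtain ⟨P, -, hPU, hP⟩ := exists_between ⊥ U bot_le 1 (by simp) (by omega)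
  obtain ⟨P', -, hPU', hP'⟩ := exists_between ⊥ U' bot_le 1 (by simp) (by omega)
  obtain ⟨U'', hs, -, hU''⟩ := exists_between (P ⊔ P') ⊤ le_top (h + 1)
    (by have := Submodule.finrank_add_le_finrank_add_finrank P P'; omega)
    (by rw [finrank_top]; omega)
  rw [step2 π h hh hπ P U hPU hP hU, step2 π h hh hπ P' U' hPU' hP' hU',
    ← step2 π h hh hπ P U'' (le_sup_left.trans hs) hP hU'',
    ← step2 π h hh hπ P' U'' (le_sup_right.trans hs) hP' hU'']

lemma step4 (h : ℕ) (hh : 1 ≤ h) (hr : h < Module.finrank F V)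
    (hπ : ∀ W : Submodule F V, Module.finrank F W = h → π (chi W) = 0)
    (e : A) (he : ∀ U : Submodule F V, Module.finrank F U = h + 1 → π (chi U) = e)
    (he0 : (gNum qq h : ℤ) • e = 0) (n : ℕ) (hn : h ≤ n)
    (U : Submodule F V) (hU : Module.finrank F U = n) :
    π (chi U) = (gNum qq n : ℤ) • e := by
  induction n using Nat.strong_induction_on generalizing U with
  | _ n ih =>
    rcases Nat.lt_or_ge n (h + 2) with hlt | hge
    · obtain rfl | rfl : n = h ∨ n = h + 1 := by omega
      · rw [hπ U hU, he0]
      · rw [he U hU, gNum_succ']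
        push_cast
        rw [add_smul, mul_smul, he0, smul_zero, one_smul, add_zero]
    · obtain ⟨m, rfl⟩ : ∃ m, n = m + 2 := ⟨n - 2, by omega⟩
      obtain ⟨T, -, hTU, hT⟩ := exists_between ⊥ U bot_le m (by simp) (by omega)
      obtain ⟨ι, _, H, h1, h2, h3⟩ := hyperplanes T U hTU m 1 hT (by omega)
      have h4 := congrArg π h3
      rw [map_sum, map_add, map_zsmul, map_zsmul, ih m (by omega) (by omega) T hT,
        Finset.sum_congr rfl (fun j _ => ih (m + 1) (by omega) (by omega) (H j) (h2 j)),
        Finset.sum_const, Finset.card_univ, h1] at h4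
      have e1 : (gNum qq 1 : ℤ) = 1 := by simp [gNum]
      have e2 : gNum qq (1 + 1) = 1 + qq := by simp [gNum, Finset.sum_range_succ]
      rw [e1, e2, one_smul, pow_one, smul_smul, ← natCast_zsmul, smul_smul] at h4
      rw [eq_sub_of_add_eq h4.symm, ← sub_smul]
      congr 1
      rw [gNum_succ' qq (m + 1), gNum_succ' qq m]
      push_cast
      ring

lemma gNum_add (q a b : ℕ) : gNum q (a + b) = gNum q a + q ^ a * gNum q b := by
  induction b with
  | zero => simp [gNum]
  | succ b ih => rw [← add_assoc, gNum_succ, ih, gNum_succ]; ring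

lemma step5 (h : ℕ) (hh : 1 ≤ h) (hr : h < Module.finrank F V)
    (hπ : ∀ W : Submodule F V, Module.finrank F W = h → π (chi W) = 0)
    (e : A) (he : ∀ U : Submodule F V, Module.finrank F U = h + 1 → π (chi U) = e)
    (he0 : (gNum qq h : ℤ) • e = 0) (i : ℕ) (c : ℤ) (hc : i < h → ((qq : ℤ) ^ (h - i)) ∣ c)
    (U : Submodule F V) (hU : Module.finrank F U = i) :
    c • π (chi U) = (c * gNum qq i) • e := by
  rcases Nat.lt_or_ge i h with hlt | hge
  · obtain ⟨b, rfl⟩ := hc hlt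
    obtain ⟨d, rfl⟩ : ∃ d, h = d + i := ⟨h - i, by omega⟩
    obtain ⟨W, hs, -, hW⟩ := exists_between U ⊤ le_top (d + i + 1) (by omega)
      (by rw [finrank_top]; omega)
    have h1 := step1 π _ hπ U W hs i d hU (by omega) hW
    rw [he W hW] at h1
    rw [Nat.add_sub_cancel, mul_comm, mul_smul, eq_neg_of_add_eq_zero_right h1, mul_assoc, mul_smul]
    congr 1
    rw [gNum_add] at he0
    push_cast at he0
    rw [add_smul] at he0
    exact (eq_neg_of_add_eq_zero_right he0).symm
  · rw [step4 π h hh hr hπ e he he0 i hge U hU, smul_smul]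

lemma step6 (h : ℕ) (hh : 1 ≤ h) (hr : h < Module.finrank F V)
    (hπ : ∀ W : Submodule F V, Module.finrank F W = h → π (chi W) = 0)
    (s : Finset ℕ) (c : ℕ → ℤ) (C : ℕ → Submodule F V)
    (hc : ∀ i ∈ s, i < h → ((qq : ℤ) ^ (h - i)) ∣ c i)
    (hC : ∀ i ∈ s, Module.finrank F (C i) = i)
    (hsum : (gNum qq h : ℤ) ∣ ∑ i ∈ s, c i * (gNum qq i : ℤ)) :
    π (∑ i ∈ s, c i • chi (C i)) = 0 := by
  obtain ⟨U, -, -, hU⟩ := exists_between (⊥ : Submodule F V) ⊤ le_top (h + 1) (by simp)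
    (by rw [finrank_top]; omega)
  have he0 := step0 π h hπ U hU
  rw [map_sum, Finset.sum_congr rfl (fun i hi => by
    rw [map_zsmul, step5 π h hh hr hπ (π (chi U))
      (fun U' hU' => step3 π h hh hr hπ U' U hU' hU) he0 i (c i) (hc i hi) (C i) (hC i hi)]),
    ← Finset.sum_smul]
  obtain ⟨b, hb⟩ := hsum
  rw [hb, mul_comm, mul_smul, he0, smul_zero]

/-- any element of the lattice becomes effective after adding a constant -/
lemma effective (h : ℕ) (f : {v : V // v ≠ 0} → ℤ)
    (hf : f ∈ AddSubgroup.closure {f | ∃ W : Submodule F V, Module.finrank F W = h ∧ f = chi W}) :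
    ∃ (k : ℤ) (S : Multiset (Submodule F V)), (∀ W ∈ S, Module.finrank F W = h) ∧
      ∀ v, f v + k = (S.map fun W => chi W v).sum := by
  have : Finite V := Module.finite_of_finite F
  have : Finite (Submodule F V) := inferInstance
  let _ : Fintype (Submodule F V) := Fintype.ofFinite _
  let all : Finset (Submodule F V) := Finset.univ.filter fun W => Module.finrank F W = h
  have hall : ∃ c : ℤ, ∀ v : {v : V // v ≠ 0}, ∑ W ∈ all, chi W v = c := by
    by_cases hne : Nonempty {v : V // v ≠ 0}
    · obtain ⟨v0⟩ := hne
      refine ⟨∑ W ∈ all, chi W v0, fun v => ?_⟩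
      obtain ⟨g, hg⟩ := exists_equiv (F := F) v.1 v0.1 v.2 v0.2
      refine Finset.sum_bij' (fun W _ => W.map (g : V →ₗ[F] V))
        (fun W _ => W.map (g.symm : V →ₗ[F] V)) ?_ ?_ ?_ ?_ ?_
      · intro W hW
        simp only [all, Finset.mem_filter, Finset.mem_univ, true_and] at hW ⊢
        rw [← hW]
        exact LinearEquiv.finrank_map_eq g W
      · intro W hW
        simp only [all, Finset.mem_filter, Finset.mem_univ, true_and] at hW ⊢
        rw [← hW]
        exact LinearEquiv.finrank_map_eq g.symm W
      · intro W _
        rw [← Submodule.map_comp]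
        simp
      · intro W _
        rw [← Submodule.map_comp]
        simp
      · intro W _
        unfold chi
        congr 1
        rw [← hg]
        simp
    · exact ⟨0, fun v => (hne ⟨v⟩).elim⟩
  obtain ⟨c, hc⟩ := hall
  rw [← AddSubgroup.mem_toAddSubmonoid, AddSubgroup.closure_toAddSubmonoid] at hf
  induction hf using AddSubmonoid.closure_induction with
  | mem x hx =>
    rcases hx with ⟨W, hW, rfl⟩ | ⟨W, hW, hx⟩
    · exact ⟨0, {W}, by simpa using hW, by simp⟩
    · refine ⟨c, (all.erase W).val, ?_, ?_⟩
      · intro W' hW'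
        have : W' ∈ all.erase W := hW'
        simp only [all, Finset.mem_erase, Finset.mem_filter] at this
        exact this.2.2
      · intro v
        have hWm : W ∈ all := by simp [all, hW]
        have h1 := Finset.add_sum_erase all (fun W => chi W v) hWm
        have h2 : x v = - chi W v := by
          rw [← hx]; simp
        change _ = ∑ W' ∈ all.erase W, chi W' v
        rw [hc] at h1
        rw [h2]
        linarith
  | zero => exact ⟨0, 0, by simp, by simp⟩
  | add x y _ _ hx hy =>
    obtain ⟨k, S, h1, h2⟩ := hx
    obtain ⟨k', S', h1', h2'⟩ := hy
    refine ⟨k + k', S + S', ?_, ?_⟩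
    · intro W hW
      rcases Multiset.mem_add.1 hW with hW | hW
      · exact h1 W hW
      · exact h1' W hW
    · intro v
      rw [Multiset.map_add, Multiset.sum_add, ← h2, ← h2', Pi.add_apply]
      ring

end algebra

lemma exists_chain (F : Type u) [Field F] (r : ℕ) :
    ∃ C : ℕ → Submodule F (Fin r → F), (∀ i ≤ r, Module.finrank F (C i) = i) ∧ Monotone C := by
  have hstep : ∀ W : Submodule F (Fin r → F), ∃ W' : Submodule F (Fin r → F), W ≤ W' ∧
      (Module.finrank F W + 1 ≤ r → Module.finrank F W' = Module.finrank F W + 1) := by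
    intro W
    by_cases h : Module.finrank F W + 1 ≤ r
    · obtain ⟨W', h1, -, h2⟩ := exists_between W ⊤ le_top (Module.finrank F W + 1) (by omega)
        (by rw [finrank_top]; simpa using h)
      exact ⟨W', h1, fun _ => h2⟩
    · exact ⟨W, le_rfl, fun h' => (h h').elim⟩
  choose N hN1 hN2 using hstep
  refine ⟨fun n => N^[n] ⊥, ?_, ?_⟩
  · intro i
    induction i with
    | zero => intro _; exact finrank_bot F (Fin r → F)
    | succ i ih =>
      intro hi
      have := ih (by omega)
      beta_reduce at this ⊢
      rw [Function.iterate_succ_apply', hN2 _ (by omega), this]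
  · refine monotone_nat_of_le_succ fun n => ?_
    simp only [Function.iterate_succ_apply']
    exact hN1 _

lemma gNum_mul (q n : ℕ) (hq : 1 ≤ q) : gNum q n * (q - 1) = q ^ n - 1 := by
  unfold gNum
  exact geom_sum_mul_of_one_le hq n

lemma gNum_gcd (q a b : ℕ) (hq : 2 ≤ q) :
    gNum q (Nat.gcd a b) = Nat.gcd (gNum q a) (gNum q b) := by
  have h := Nat.pow_sub_one_gcd_pow_sub_one q a b
  rw [← gNum_mul q a (by omega), ← gNum_mul q b (by omega), ← gNum_mul q (a.gcd b) (by omega),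
    Nat.gcd_mul_right] at h
  exact (Nat.eq_of_mul_eq_mul_right (by omega) h).symm

lemma exists_sigma (q r h : ℕ) (hq : 2 ≤ q) (t : ℤ) (ht : (gNum q (Nat.gcd r h) : ℤ) ∣ t) :
    ∃ s : ℤ, (gNum q h : ℤ) ∣ s * gNum q r - t := by
  obtain ⟨b, rfl⟩ := ht
  rw [gNum_gcd q r h hq, Nat.gcd_eq_gcd_ab]
  refine ⟨Nat.gcdA (gNum q r) (gNum q h) * b, - (Nat.gcdB (gNum q r) (gNum q h) * b), ?_⟩
  ring

end HP

theorem statement0 (F : Type*) [Field F] [Fintype F] (q r h : ℕ)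
    (hq : q = Fintype.card F) (hh : 1 ≤ h) (hhr : h < r) (ε : ℕ → ℤ)
    (hdiv : ∀ i ∈ Finset.Icc 1 (h - 1), ((q : ℤ) ^ (h - i)) ∣ ε i)
    (hmod : ((gNum q (Nat.gcd r h) : ℤ)) ∣
      ∑ i ∈ Finset.Icc 1 (r - 1), ε i * (gNum q i : ℤ)) :
    ∃ σ : ℕ, IsHPartitionable F r h σ ε := by
  subst hq
  have hq2 : 2 ≤ Fintype.card F := Fintype.one_lt_card
  obtain ⟨C, hC1, hC2⟩ := HP.exists_chain F r
  obtain ⟨s, hs⟩ := HP.exists_sigma _ r h hq2 _ hmod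
  have hIcc : Finset.Icc 1 r = insert r (Finset.Icc 1 (r - 1)) := by
    ext i
    simp only [Finset.mem_Icc, Finset.mem_insert]
    omega
  have hnot : r ∉ Finset.Icc 1 (r - 1) := by
    simp only [Finset.mem_Icc]
    omega
  let c : ℕ → ℤ := fun i => if i = r then s else - ε i
  have hcr : c r = s := by simp [c]
  have hci : ∀ i ∈ Finset.Icc 1 (r - 1), c i = - ε i := by
    intro i hi
    have : i ≠ r := by rintro rfl; exact hnot hi
    simp [c, this]
  let G : Set ({v : Fin r → F // v ≠ 0} → ℤ) :=
    {f | ∃ W : Submodule F (Fin r → F), Module.finrank F W = h ∧ f = HP.chi W}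
  have key := HP.step6 (QuotientAddGroup.mk' (AddSubgroup.closure G)) h hh (by simpa using hhr)
    (by
      intro W hW
      rw [QuotientAddGroup.mk'_apply, QuotientAddGroup.eq_zero_iff]
      exact AddSubgroup.subset_closure ⟨W, hW, rfl⟩)
    (Finset.Icc 1 r) c C
    (by
      intro i hi hih
      rw [Finset.mem_Icc] at hi
      rw [hci i (by rw [Finset.mem_Icc]; omega), dvd_neg]
      exact hdiv i (by rw [Finset.mem_Icc]; omega))
    (by
      intro i hi
      rw [Finset.mem_Icc] at hi
      exact hC1 i hi.2)
    (by
      rw [hIcc, Finset.sum_insert hnot, hcr,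
        Finset.sum_congr rfl (fun i hi => by rw [hci i hi, neg_mul]), Finset.sum_neg_distrib,
        ← sub_eq_add_neg]
      exact hs)
  rw [QuotientAddGroup.mk'_apply, QuotientAddGroup.eq_zero_iff] at key
  obtain ⟨k, S, hS1, hS2⟩ := HP.effective h _ key
  have hCr : C r = ⊤ := by
    apply Submodule.eq_top_of_finrank_eq
    rw [hC1 r le_rfl]
    simp
  have hS3 : ∀ v : {v : Fin r → F // v ≠ 0}, (S.map fun W => HP.chi W v).sum
      = (s + k) - ∑ i ∈ Finset.Icc 1 (r - 1), (if v.1 ∈ C i then ε i else 0) := by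
    intro v
    rw [← hS2 v, hIcc, Finset.sum_insert hnot, hcr, hCr, Pi.add_apply, Finset.sum_apply,
      Finset.sum_congr rfl (g := fun i => - (if v.1 ∈ C i then ε i else 0)) (fun i hi => by
        rw [hci i hi]
        by_cases hv : v.1 ∈ C i <;> simp [HP.chi, hv]), Finset.sum_neg_distrib]
    simp [HP.chi]
    ring
  have hS4 : ∀ v : {v : Fin r → F // v ≠ 0}, (S.map fun W => HP.chi W v).sum
      = (mult S (Submodule.span F {v.1}) : ℤ) := by
    intro v
    unfold mult
    clear hS1 hS2 hS3
    induction S using Multiset.induction_on with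
    | empty => simp
    | cons W S ih =>
      rw [Multiset.map_cons, Multiset.sum_cons, ih, Multiset.countP_cons]
      by_cases hv : v.1 ∈ W <;> simp [HP.chi, hv, add_comm]
  have hpos : 0 ≤ s + k := by
    have hlt : C (r - 1) < ⊤ := by
      rw [lt_top_iff_ne_top]
      intro htop
      have h1 := hC1 (r - 1) (by omega)
      rw [htop, finrank_top] at h1
      simp at h1
      omega
    obtain ⟨v, -, hv⟩ := SetLike.exists_of_lt hlt
    have hv0 : v ≠ 0 := by rintro rfl; exact hv (Submodule.zero_mem _)
    have h3 := hS3 ⟨v, hv0⟩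
    rw [hS4, Finset.sum_eq_zero, sub_zero] at h3
    · rw [← h3]; positivity
    · intro i hi
      rw [Finset.mem_Icc] at hi
      exact if_neg fun hvi => hv (hC2 hi.2 hvi)
  refine ⟨(s + k).toNat, C, S, ?_, ?_, hS1, ?_⟩
  · intro i hi
    rw [Finset.mem_Icc] at hi
    exact hC1 i (by omega)
  · intro i j _ hij _
    exact hC2 hij
  · intro P hP
    obtain ⟨v, hv0, hv⟩ := finrank_eq_one_iff'.1 hP
    have hPv : P = Submodule.span F {v.1} := by
      apply le_antisymm
      · intro w hw
        obtain ⟨a, ha⟩ := hv ⟨w, hw⟩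
        rw [Submodule.mem_span_singleton]
        exact ⟨a, congrArg Subtype.val ha⟩
      · rw [Submodule.span_singleton_le_iff_mem]
        exact v.2
    have hv0' : v.1 ≠ 0 := by simpa using hv0
    have h3 := hS3 ⟨v.1, hv0'⟩
    rw [hS4] at h3
    rw [hPv, h3, Int.toNat_of_nonneg hpos]
    simp only [Submodule.span_singleton_le_iff_mem]
end
end

section
/- Let q be a prime power and r > h ≥ 1 be integers. Then there exists s₀ ∈ ℕ such that for every integer s ≥ s₀, n_q(r,h;s) equals the largest integer n satisfying [h]_q·n ≥ g_q(r, q^{h−1}·(n−s)) (in particular, for each such s the set of integers n satisfying this inequality is bounded above, and its maximum — the Griesmer upper bound — is attained by n_q(r,h;s)). -/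
open scoped Classical

noncomputable section

/-- The Griesmer function `g_q(k,d) = ∑_{i=0}^{k-1} ⌈d / qⁱ⌉`. -/
def griesmer (q k d : ℕ) : ℕ := ∑ i ∈ Finset.range k, (d + q ^ i - 1) / q ^ i

/-- The number of elements of the multiset `S` of subspaces contained in the subspace `U`,
counted with multiplicity. -/
def cnt {F V : Type*} [Field F] [AddCommGroup V] [Module F V]
    (S : Multiset (Submodule F V)) (U : Submodule F V) : ℕ :=
  Multiset.countP (fun W => W ≤ U) S

open Module

theorem cd_le_iff (d b x : ℕ) (hb : 0 < b) : (d + b - 1) / b ≤ x ↔ d ≤ b * x := by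
  rw [← Nat.lt_succ_iff, Nat.div_lt_iff_lt_mul hb, Nat.succ_mul, mul_comm x b]
  omega

theorem cd_eq (d b x : ℕ) (hb : 0 < b) (h : ∀ y, d ≤ b * y ↔ x ≤ y) : (d + b - 1) / b = x := by
  apply le_antisymm
  · rw [cd_le_iff _ _ _ hb, h]
  · rw [← h, ← cd_le_iff _ _ _ hb]

theorem cd_cd (d q i : ℕ) (hq : 0 < q) :
    (d + q ^ (i + 1) - 1) / q ^ (i + 1) = ((d + q - 1) / q + q ^ i - 1) / q ^ i := by
  apply cd_eq _ _ _ (by positivity)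
  intro y
  rw [cd_le_iff _ _ _ (by positivity), cd_le_iff _ _ _ hq, pow_succ']
  rw [mul_assoc]

theorem griesmer_succ (q k d : ℕ) (hq : 0 < q) :
    griesmer q (k + 1) d = d + griesmer q k ((d + q - 1) / q) := by
  unfold griesmer
  rw [Finset.sum_range_succ', add_comm]
  congr 1
  · simp
  · exact Finset.sum_congr rfl fun i _ => cd_cd d q i hq

theorem griesmer_eq (q h t m : ℕ) (hq : 0 < q) (hh : 1 ≤ h) :
    griesmer q (h + t) (q ^ (h - 1) * m) =
      gNum q h * m + ∑ j ∈ Finset.range t, (m + q ^ (j + 1) - 1) / q ^ (j + 1) := by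
  unfold griesmer
  rw [Finset.sum_range_add]
  congr 1
  · rw [gNum, ← Finset.sum_range_reflect (fun j => q ^ j), Finset.sum_mul]
    apply Finset.sum_congr rfl
    intro i hi
    rw [Finset.mem_range] at hi
    apply cd_eq _ _ _ (by positivity)
    intro y
    obtain ⟨c, rfl⟩ : ∃ c, h = i + 1 + c := ⟨h - (i + 1), by omega⟩
    have h1 : i + 1 + c - 1 = i + c := by omega
    have h2 : i + c - i = c := by omega
    rw [h1, h2, pow_add, mul_assoc]
    exact Nat.mul_le_mul_left_iff (by positivity)
  · apply Finset.sum_congr rfl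
    intro j _
    apply cd_eq _ _ _ (by positivity)
    intro y
    rw [cd_le_iff _ _ _ (by positivity)]
    obtain ⟨c, rfl⟩ : ∃ c, h = 1 + c := ⟨h - 1, by omega⟩
    have h1 : q ^ (1 + c + j) * y = q ^ c * (q ^ (j + 1) * y) := by ring
    have h2 : 1 + c - 1 = c := by omega
    rw [h1, h2]
    exact Nat.mul_le_mul_left_iff (by positivity)

set_option linter.unusedSectionVars false

section lin

variable {F V : Type*} [Field F] [Fintype F] [AddCommGroup V] [Module F V] [FiniteDimensional F V]

theorem finrank_inf_ker (C : Submodule F V) (f : Dual F V) (hf : ¬ C ≤ LinearMap.ker f) :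
    finrank F (C ⊓ LinearMap.ker f : Submodule F V) + 1 = finrank F C := by
  have hf0 : f ≠ 0 := by
    rintro rfl
    exact hf (by simp)
  have h1 := Module.Dual.finrank_ker_add_one_of_ne_zero hf0
  have h2 := Submodule.finrank_sup_add_finrank_inf_eq C (LinearMap.ker f)
  have hlt : LinearMap.ker f < C ⊔ LinearMap.ker f := by
    rw [right_lt_sup]; exact hf
  have h3 := Submodule.finrank_lt_finrank_of_lt hlt
  have h4 := Submodule.finrank_le (C ⊔ LinearMap.ker f)
  omega

theorem griesmer_bound {ι : Type*} (φ : ι → Dual F V) (q : ℕ) (hq : q = Fintype.card F) (k : ℕ) :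
    ∀ (X : Submodule F V), finrank F X = k → ∀ (T : Finset ι) (d : ℕ),
      (∀ f ∈ X, f ≠ 0 → d ≤ (T.filter (fun i => φ i f ≠ 0)).card) → griesmer q k d ≤ T.card := by
  have hq1 : 1 < q := hq ▸ Fintype.one_lt_card
  induction k with
  | zero => intro X _ T d _; simp [griesmer]
  | succ k ih =>
    intro X hX T d hd
    let wt : V → ℕ := fun f => (T.filter (fun i => φ i f ≠ 0)).card
    have hne : ∃ n, ∃ f ∈ X, f ≠ 0 ∧ wt f = n := by
      have hX0 : X ≠ ⊥ := by
        rintro rfl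
        simp at hX
      obtain ⟨f, hf, hf0⟩ := X.exists_mem_ne_zero_of_ne_bot hX0
      exact ⟨_, f, hf, hf0, rfl⟩
    obtain ⟨f0, hf0X, hf0, hw⟩ := Nat.find_spec hne
    have hmin : ∀ f ∈ X, f ≠ 0 → wt f0 ≤ wt f := by
      intro f hf hf'
      rw [hw]
      exact Nat.find_min' hne ⟨f, hf, hf', rfl⟩
    obtain ⟨g, hg⟩ := Module.Projective.exists_dual_ne_zero F hf0
    have hXg : ¬ X ≤ LinearMap.ker g := fun hle => hg (hle hf0X)
    have hfr := finrank_inf_ker X g hXg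
    let T0 := T.filter (fun i => φ i f0 = 0)
    have hT : T0.card + wt f0 = T.card :=
      Finset.card_filter_add_card_filter_not (s := T) (fun i => φ i f0 = 0)
    have key := ih (X ⊓ LinearMap.ker g) (by omega) T0 ((d + q - 1) / q) ?_
    · rw [griesmer_succ _ _ _ (by omega)]
      have := hd f0 hf0X hf0
      change d ≤ wt f0 at this
      omega
    · rintro f ⟨hfX, hfg⟩ hfne
      rw [cd_le_iff _ _ _ (by omega)]
      refine (hd f0 hf0X hf0).trans ?_
      change wt f0 ≤ _
      have hlow : q * wt f0 ≤ ∑ a : F, wt (f - a • f0) := by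
        calc q * wt f0 = ∑ a : F, wt f0 := by simp [hq]
          _ ≤ _ := by
            apply Finset.sum_le_sum
            intro a _
            apply hmin
            · exact X.sub_mem hfX (X.smul_mem _ hf0X)
            · intro h0
              rw [sub_eq_zero] at h0
              have : g f = 0 := hfg
              rw [h0, map_smul, smul_eq_mul, mul_eq_zero] at this
              rcases this with h | h
              · rw [h, zero_smul] at h0; exact hfne h0
              · exact hg h
      have hup : ∑ a : F, wt (f - a • f0) =
          (q - 1) * wt f0 + q * (T0.filter (fun i => φ i f ≠ 0)).card := by
        have e1 : ∑ a : F, wt (f - a • f0) =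
            ∑ i ∈ T, (Finset.univ.filter (fun a : F => φ i (f - a • f0) ≠ 0)).card := by
          simp only [wt, Finset.card_filter]
          exact Finset.sum_comm
        rw [e1, ← Finset.sum_filter_add_sum_filter_not T (fun i => φ i f0 = 0), add_comm]
        congr 1
        · rw [mul_comm]
          apply Finset.sum_const_nat
          intro i hi
          have hi0 : φ i f0 ≠ 0 := (Finset.mem_filter.1 hi).2
          have : (Finset.univ.filter (fun a : F => φ i (f - a • f0) ≠ 0)) =
              Finset.univ.erase (φ i f / φ i f0) := by
            ext a
            simp only [map_sub, map_smul, smul_eq_mul, Finset.mem_filter, Finset.mem_univ, true_and,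
              Finset.mem_erase, and_true, sub_ne_zero, ne_eq, not_iff_not]
            rw [eq_div_iff hi0, eq_comm]
          rw [this, Finset.card_erase_of_mem (Finset.mem_univ _), Finset.card_univ, hq]
        · rw [Finset.card_filter, Finset.mul_sum]
          apply Finset.sum_congr rfl
          intro i hi
          have hi0 : φ i f0 = 0 := (Finset.mem_filter.1 hi).2
          by_cases hc : φ i f = 0 <;> simp [hi0, hc, hq]
      rw [hup] at hlow
      obtain ⟨p, rfl⟩ : ∃ p, q = p + 1 := ⟨q - 1, by omega⟩
      rw [Nat.add_sub_cancel] at hlow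
      nlinarith

theorem finrank_sup_of_disjoint (A C : Submodule F V) (h : Disjoint A C) :
    finrank F (A ⊔ C : Submodule F V) = finrank F A + finrank F C := by
  have h2 := Submodule.finrank_sup_add_finrank_inf_eq A C
  rw [h.eq_bot, finrank_bot] at h2
  omega

theorem exists_submodule_between (A B : Submodule F V) (hAB : A ≤ B) (k : ℕ)
    (hk : finrank F A + k ≤ finrank F B) :
    ∃ D, A ≤ D ∧ D ≤ B ∧ finrank F D = finrank F A + k := by
  induction k with
  | zero => exact ⟨A, le_rfl, hAB, rfl⟩
  | succ k ih =>
    obtain ⟨D, hAD, hDB, hD⟩ := ih (by omega)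
    have hlt : D < B := by
      refine lt_of_le_of_ne hDB ?_
      rintro rfl
      omega
    obtain ⟨v, hvB, hvD⟩ := SetLike.exists_of_lt hlt
    have hv0 : v ≠ 0 := by rintro rfl; exact hvD D.zero_mem
    refine ⟨D ⊔ F ∙ v, hAD.trans le_sup_left, sup_le hDB ?_, ?_⟩
    · rwa [Submodule.span_singleton_le_iff_mem]
    · rw [finrank_sup_of_disjoint, finrank_span_singleton hv0, hD]; · omega
      rw [Submodule.disjoint_span_singleton' hv0]
      exact hvD

/-- lines contained in `D` -/
def lines (D : Submodule F V) : Finset (Submodule F V) :=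
  haveI : Finite V := Module.finite_of_finite F
  haveI : Fintype (Submodule F V) := Fintype.ofFinite _
  Finset.univ.filter (fun l => finrank F l = 1 ∧ l ≤ D)

theorem mem_lines (D l : Submodule F V) : l ∈ lines D ↔ finrank F l = 1 ∧ l ≤ D := by
  simp [lines]

theorem card_lines (q : ℕ) (hq : q = Fintype.card F) (D : Submodule F V) :
    (lines D).card = gNum q (finrank F D) := by
  have : Finite V := Module.finite_of_finite F
  have h1 := Projectivization.card_of_finrank F D (n := finrank F D) rfl
  rw [Nat.card_eq_fintype_card (α := F), ← hq] at h1
  rw [gNum, ← h1, Nat.card_congr (Projectivization.equivSubmodule F D)]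
  have : Fintype { H : Submodule F D // finrank F H = 1 } := Fintype.ofFinite _
  rw [Nat.card_eq_fintype_card]
  symm
  have himg : lines D = Finset.univ.image
      (fun H : { H : Submodule F D // finrank F H = 1 } => H.1.map D.subtype) := by
    ext l
    rw [mem_lines]
    simp only [Finset.mem_image, Finset.mem_univ, true_and, Subtype.exists, exists_prop]
    constructor
    · rintro ⟨h1, h2⟩
      refine ⟨l.comap D.subtype, ?_, ?_⟩
      · rw [← h1]
        exact (Submodule.comapSubtypeEquivOfLe h2).finrank_eq
      · rw [Submodule.map_comap_subtype, inf_eq_right.2 h2]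
    · rintro ⟨H, hH, rfl⟩
      refine ⟨?_, Submodule.map_subtype_le _ _⟩
      rw [Submodule.finrank_map_subtype_eq, hH]
  rw [himg, Finset.card_image_of_injective, Finset.card_univ]
  intro H K hHK
  apply Subtype.ext
  exact Submodule.map_injective_of_injective D.injective_subtype hHK

theorem gNum_succ (q i : ℕ) : gNum q (i + 1) = gNum q i + q ^ i := by
  simp [gNum, Finset.sum_range_succ]

theorem lines_ker (q : ℕ) (hq : q = Fintype.card F) (C : Submodule F V) (k : ℕ)
    (hk : finrank F C = k + 1) (f : Dual F V) :
    ((lines C).filter (fun l => l ≤ LinearMap.ker f)).card =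
      gNum q k + q ^ k * (if C ≤ LinearMap.ker f then 1 else 0) := by
  have e : (lines C).filter (fun l => l ≤ LinearMap.ker f) = lines (C ⊓ LinearMap.ker f) := by
    ext l
    simp only [Finset.mem_filter, mem_lines, le_inf_iff, and_assoc]
  rw [e, card_lines q hq]
  split_ifs with hc
  · rw [inf_eq_left.2 hc, hk, gNum_succ, mul_one]
  · have := finrank_inf_ker C f hc
    have h2 : finrank F (C ⊓ LinearMap.ker f : Submodule F V) = k := by omega
    rw [h2]; simp

theorem exists_gen (l : Submodule F V) : ∃ v : V, finrank F l = 1 → l = F ∙ v := by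
  by_cases h : finrank F l = 1
  · obtain ⟨v, hv, hv2⟩ := finrank_eq_one_iff'.1 h
    refine ⟨v, fun _ => ?_⟩
    apply le_antisymm
    · intro w hw
      obtain ⟨c, hc⟩ := hv2 ⟨w, hw⟩
      rw [Submodule.mem_span_singleton]
      exact ⟨c, congrArg Subtype.val hc⟩
    · rw [Submodule.span_singleton_le_iff_mem]
      exact v.2
  · exact ⟨0, fun h' => absurd h' h⟩

theorem countP_eq_sum {α : Type*} (L : List α) (p : α → Prop) :
    L.countP (fun x => decide (p x)) = ∑ j : Fin L.length, (if p L[j] then 1 else 0) := by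
  induction L with
  | nil => simp
  | cons a L ih =>
    rw [List.countP_cons, ih]
    simp only [List.length_cons]
    rw [Fin.sum_univ_succ]
    simp only [add_comm]
    congr 1
    by_cases hp : p a <;> simp [hp]

/-- The Griesmer upper bound. -/
theorem upper_bound (q h r s n : ℕ) (hq : q = Fintype.card F) (hh : 1 ≤ h) (hhr : h < r)
    (hV : finrank F V = r) (S : Multiset (Submodule F V)) (hn : Multiset.card S = n)
    (hS : ∀ W ∈ S, finrank F W ≤ h)
    (hH : ∀ H : Submodule F V, finrank F H = r - 1 → cnt S H ≤ s) :
    griesmer q r (q ^ (h - 1) * (n - s)) ≤ gNum q h * n := by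
  obtain ⟨L, rfl⟩ := Quot.exists_rep S
  change L.length = n at hn
  have hext : ∀ j : Fin L.length, ∃ D, L[j] ≤ D ∧ finrank F D = h := by
    intro j
    have h1 := hS L[j] (List.getElem_mem _)
    obtain ⟨D, hD1, _, hD⟩ := exists_submodule_between L[j] ⊤ le_top (h - finrank F L[j])
      (by rw [finrank_top, hV]; omega)
    exact ⟨D, hD1, by omega⟩
  choose D hLD hD using hext
  choose gen hgen using (exists_gen (F := F) (V := V))
  let T : Finset (Σ _ : Fin L.length, Submodule F V) := Finset.univ.sigma fun j => lines (D j)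
  have hTc : T.card = gNum q h * n := by
    simp only [T, Finset.card_sigma, card_lines q hq, hD, Finset.sum_const, Finset.card_univ,
      Fintype.card_fin, hn, smul_eq_mul, mul_comm]
  rw [← hTc]
  refine griesmer_bound (V := Dual F V) (fun i => Dual.eval F V (gen i.2)) q hq r ⊤ ?_ T _ ?_
  · rw [finrank_top, Subspace.dual_finrank_eq, hV]
  · intro f _ hf
    have hker : finrank F (LinearMap.ker f) = r - 1 := by
      have := Module.Dual.finrank_ker_add_one_of_ne_zero hf
      omega
    have hcnt := hH _ hker
    have hfil : T.filter (fun i => Dual.eval F V (gen i.2) f ≠ 0) =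
        Finset.univ.sigma fun j => (lines (D j)).filter (fun l => ¬ l ≤ LinearMap.ker f) := by
      ext ⟨j, l⟩
      simp only [T, Finset.mem_filter, Finset.mem_sigma, Finset.mem_univ, true_and]
      refine and_congr_right fun hl => ?_
      rw [mem_lines] at hl
      rw [not_iff_not]
      conv_rhs => rw [hgen l hl.1]
      rw [Submodule.span_singleton_le_iff_mem]
      rfl
    rw [hfil, Finset.card_sigma]
    have hj : ∀ j : Fin L.length, ((lines (D j)).filter (fun l => ¬ l ≤ LinearMap.ker f)).card =
        q ^ (h - 1) * (if D j ≤ LinearMap.ker f then 0 else 1) := by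
      intro j
      have h1 := lines_ker q hq (D j) (h - 1) (by rw [hD]; omega) f
      have h2 := Finset.card_filter_add_card_filter_not (s := lines (D j))
        (fun l => l ≤ LinearMap.ker f)
      rw [card_lines q hq, hD] at h2
      obtain ⟨c, rfl⟩ : ∃ c, h = c + 1 := ⟨h - 1, by omega⟩
      rw [gNum_succ] at h2
      rw [Nat.add_sub_cancel] at h1 ⊢
      split_ifs at h1 ⊢ <;> omega
    simp only [hj]
    rw [← Finset.mul_sum]
    apply Nat.mul_le_mul_left
    have hc : ∑ j : Fin L.length, (if D j ≤ LinearMap.ker f then 1 else 0) ≤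
        cnt (Quot.mk _ L) (LinearMap.ker f) := by
      have : cnt (Quot.mk _ L) (LinearMap.ker f) =
          ∑ j : Fin L.length, (if L[j] ≤ LinearMap.ker f then 1 else 0) := by
        change L.countP _ = _
        convert countP_eq_sum L (fun W => W ≤ LinearMap.ker f)
      rw [this]
      apply Finset.sum_le_sum
      intro j _
      split_ifs with h1 h2
      · exact le_rfl
      · exact absurd ((hLD j).trans h1) h2
      · simp
      · simp
    have htot : ∑ j : Fin L.length, (if D j ≤ LinearMap.ker f then 1 else 0) +
        ∑ j : Fin L.length, (if D j ≤ LinearMap.ker f then 0 else 1) = n := by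
      rw [← Finset.sum_add_distrib, ← hn]
      rw [Finset.sum_congr rfl (g := fun _ => 1)]
      · simp
      · intro j _; split_ifs <;> rfl
    omega

end lin

section construction

variable {F V : Type*} [Field F] [Fintype F] [AddCommGroup V] [Module F V] [FiniteDimensional F V]

/-- Indicator, as a function of the functional `f`, of `W ≤ ker f`. -/
def om (W : Submodule F V) : Dual F V → ℤ := fun f => if W ≤ LinearMap.ker f then 1 else 0

theorem om_zero (W : Submodule F V) : om W 0 = 1 := by simp [om]

theorem om_nonneg (W : Submodule F V) (f) : 0 ≤ om W f := by
  unfold om; split_ifs <;> simp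

theorem om_bot (f : Dual F V) : om (⊥ : Submodule F V) f = 1 := by simp [om]

theorem om_top (f : Dual F V) (hf : f ≠ 0) : om (⊤ : Submodule F V) f = 0 := by
  rw [om, if_neg]
  intro h
  exact hf (LinearMap.ker_eq_top.1 (top_le_iff.1 h))

theorem om_sup (A C : Submodule F V) (f : Dual F V) : om (A ⊔ C) f = om A f * om C f := by
  simp only [om, sup_le_iff]
  by_cases h1 : A ≤ LinearMap.ker f <;> by_cases h2 : C ≤ LinearMap.ker f <;> simp [h1, h2]

theorem key (q : ℕ) (hq : q = Fintype.card F) (A B : Submodule F V) (hAB : A ≤ B) (k : ℕ)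
    (hk : finrank F B = finrank F A + (k + 1)) :
    ∃ T : Finset (Submodule F V),
      (∀ l ∈ T, finrank F (A ⊔ l : Submodule F V) = finrank F A + 1 ∧ A ⊔ l ≤ B) ∧
      T.card = gNum q (k + 1) ∧
      ∑ l ∈ T, om (A ⊔ l) = (gNum q k : ℤ) • om A + (q ^ k : ℤ) • om B := by
  obtain ⟨C', hC'⟩ := Submodule.exists_isCompl A
  have hdis : Disjoint A (C' ⊓ B) := hC'.disjoint.mono_right inf_le_left
  have hsup : A ⊔ (C' ⊓ B) = B := by
    rw [← sup_inf_assoc_of_le C' hAB, hC'.sup_eq_top, top_inf_eq]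
  have hfr := finrank_sup_of_disjoint A _ hdis
  rw [hsup] at hfr
  have hC : finrank F (C' ⊓ B : Submodule F V) = k + 1 := by omega
  refine ⟨lines (C' ⊓ B), ?_, ?_, ?_⟩
  · intro l hl
    rw [mem_lines] at hl
    constructor
    · rw [finrank_sup_of_disjoint _ _ (hdis.mono_right hl.2), hl.1]
    · exact sup_le hAB (hl.2.trans inf_le_right)
  · rw [card_lines q hq, hC]
  · funext f
    rw [Finset.sum_apply]
    simp only [om_sup, Pi.add_apply, Pi.smul_apply, smul_eq_mul]
    rw [← Finset.mul_sum]
    have h1 := lines_ker q hq (C' ⊓ B) k hC f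
    have h2 : ∑ l ∈ lines (C' ⊓ B), om l f =
        (((lines (C' ⊓ B)).filter (fun l => l ≤ LinearMap.ker f)).card : ℤ) := by
      rw [Finset.card_filter]
      push_cast
      rfl
    have h3 : om B f = om A f * om (C' ⊓ B) f := by rw [← om_sup, hsup]
    rw [h2, h1, h3]
    simp only [om]
    push_cast
    ring

/-- generators -/
def gens (F V : Type*) [Field F] [AddCommGroup V] [Module F V] (h : ℕ) : Set (Dual F V → ℤ) :=
  {x | ∃ W : Submodule F V, finrank F W = h ∧ om W = x}

theorem rel_i (q : ℕ) (hq : q = Fintype.card F) (h i : ℕ) (A B : Submodule F V) (hAB : A ≤ B)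
    (hA : finrank F A + 1 = h) (hB : finrank F B = h + i) :
    (q ^ i : ℤ) • om B + (gNum q i : ℤ) • om A ∈ AddSubgroup.closure (gens F V h) := by
  obtain ⟨T, h1, _, h2⟩ := key q hq A B hAB i (by omega)
  rw [add_comm, ← h2]
  apply AddSubgroup.sum_mem
  intro l hl
  apply AddSubgroup.subset_closure
  exact ⟨_, by rw [(h1 l hl).1, hA], rfl⟩

theorem gNum_succ' (q i : ℕ) : gNum q (i + 1) = q * gNum q i + 1 := by
  rw [gNum, gNum, Finset.sum_range_succ', Finset.mul_sum]
  simp [pow_succ']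

theorem rel_0 (q : ℕ) (hq : q = Fintype.card F) (h : ℕ) (A0 B : Submodule F V) (hAB : A0 ≤ B)
    (hA0 : finrank F A0 + 1 = h) (hB : finrank F B = h + 1) (j : ℕ) :
    (∀ A ≤ B, finrank F A + j = h →
      om A - (gNum q j : ℤ) • om A0 ∈ AddSubgroup.closure (gens F V h)) ∧
    (∀ A ≤ B, finrank F A + (j + 1) = h →
      om A - (gNum q (j + 1) : ℤ) • om A0 ∈ AddSubgroup.closure (gens F V h)) := by
  induction j with
  | zero =>
    constructor
    · intro A _ hA
      have : om A ∈ AddSubgroup.closure (gens F V h) :=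
        AddSubgroup.subset_closure ⟨A, by omega, rfl⟩
      simpa [gNum] using this
    · intro A hAB' hA
      have h1 := rel_i q hq h 1 A B hAB' (by omega) hB
      have h2 := rel_i q hq h 1 A0 B hAB (by omega) hB
      have h3 := AddSubgroup.sub_mem _ h1 h2
      convert h3 using 1
      simp [gNum]
  | succ j ih =>
    refine ⟨ih.2, ?_⟩
    intro A hAB' hA
    obtain ⟨D, hAD, hDB, hD⟩ := exists_submodule_between A B hAB' 2 (by omega)
    obtain ⟨T, h1, hT, h2⟩ := key q hq A D hAD 1 (by omega)
    have h3 : ∑ l ∈ T, (om (A ⊔ l) - (gNum q (j + 1) : ℤ) • om A0) ∈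
        AddSubgroup.closure (gens F V h) := by
      apply AddSubgroup.sum_mem
      intro l hl
      exact ih.2 _ ((h1 l hl).2.trans hDB) (by rw [(h1 l hl).1]; omega)
    have h4 := AddSubgroup.zsmul_mem _ (ih.1 D hDB (by omega)) (q : ℤ)
    have h5 := AddSubgroup.sub_mem _ h3 h4
    rw [Finset.sum_sub_distrib, h2, Finset.sum_const, hT] at h5
    convert h5 using 1
    funext f
    have e1 : gNum q 1 = 1 := by simp [gNum]
    have e2 : gNum q 2 = q + 1 := by rw [gNum_succ', e1]; ring
    have e3 : gNum q (j + 1 + 1) = gNum q (j + 1) + q ^ (j + 1) := gNum_succ _ _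
    have e4 : gNum q (j + 1) = gNum q j + q ^ j := gNum_succ _ _
    simp only [Pi.sub_apply, Pi.add_apply, Pi.smul_apply, smul_eq_mul, nsmul_eq_mul,
      Pi.natCast_apply, Pi.mul_apply, e1, e2, e3, e4]
    push_cast
    ring

theorem card_li (q : ℕ) (hq : q = Fintype.card F) [Fintype V] (D : Submodule F V) (h : ℕ)
    (hD : h ≤ finrank F D) :
    (Finset.univ.filter
      (fun s : Fin h → V => LinearIndependent F s ∧ ∀ i, s i ∈ D)).card =
      ∏ i : Fin h, (q ^ finrank F D - q ^ (i : ℕ)) := by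
  rw [hq, ← card_linearIndependent (K := F) (V := D) hD]
  have : Fintype { s : Fin h → D // LinearIndependent F s } := Fintype.ofFinite _
  rw [Nat.card_eq_fintype_card, ← Finset.card_univ]
  symm
  apply Finset.card_bij (fun s _ => fun i => (s.1 i : V))
  · intro s _
    rw [Finset.mem_filter]
    refine ⟨Finset.mem_univ _, ?_, fun i => (s.1 i).2⟩
    exact s.2.map' D.subtype D.ker_subtype
  · intro s _ s' _ hss
    apply Subtype.ext
    funext i
    exact Subtype.ext (congrFun hss i)
  · intro s hs
    rw [Finset.mem_filter] at hs
    refine ⟨⟨fun i => ⟨s i, hs.2.2 i⟩, ?_⟩, Finset.mem_univ _, rfl⟩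
    exact LinearIndependent.of_comp D.subtype hs.2.1

theorem exists_J (q : ℕ) (hq : q = Fintype.card F) (h t : ℕ) (hh : 1 ≤ h) (ht : 1 ≤ t)
    (hV : finrank F V = h + t) :
    ∃ (J : Dual F V → ℤ) (P : ℕ) (u : ℤ), 0 < P ∧ J ∈ AddSubmonoid.closure (gens F V h) ∧
      (∀ x ∈ gens F V h, J - x ∈ AddSubmonoid.closure (gens F V h)) ∧
      J = (P : ℤ) • om ⊥ + ((q : ℤ) ^ t * u) • om ⊤ ∧
      (P : ℤ) * gNum q h = u * gNum q t := by
  have : Finite V := Module.finite_of_finite F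
  have : Fintype V := Fintype.ofFinite _
  have hq1 : 1 < q := hq ▸ Fintype.one_lt_card
  obtain ⟨c, rfl⟩ : ∃ c, h = c + 1 := ⟨h - 1, by omega⟩
  let I := Finset.univ.filter (fun s : Fin (c + 1) → V => LinearIndependent F s)
  let w : (Fin (c + 1) → V) → (Dual F V → ℤ) := fun s => om (Submodule.span F (Set.range s))
  have hw : ∀ s ∈ I, w s ∈ gens F V (c + 1) := by
    intro s hs
    refine ⟨_, ?_, rfl⟩
    rw [finrank_span_eq_card (Finset.mem_filter.1 hs).2, Fintype.card_fin]
  have hval : ∀ f, (∑ s ∈ I, w s) f = ((Finset.univ.filter (fun s : Fin (c + 1) → V =>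
      LinearIndependent F s ∧ ∀ i, s i ∈ LinearMap.ker f)).card : ℤ) := by
    intro f
    rw [Finset.sum_apply, ← Finset.filter_filter, Finset.card_filter]
    push_cast
    apply Finset.sum_congr rfl
    intro s _
    simp only [w, om, Submodule.span_le, Set.range_subset_iff, SetLike.mem_coe]
  let Z : ℤ := ∏ i : Fin c, ((q : ℤ) ^ (c + t) - q ^ (i : ℕ))
  have hpow : ∀ a b : ℕ, a ≤ b → ((q ^ b - q ^ a : ℕ) : ℤ) = (q : ℤ) ^ b - q ^ a := by
    intro a b hab
    rw [Nat.cast_sub (Nat.pow_le_pow_right (by omega) hab)]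
    push_cast
    rfl
  let P := ∏ i : Fin (c + 1), (q ^ (c + t) - q ^ (i : ℕ))
  have hP : (P : ℤ) = Z * ((q : ℤ) ^ (c + t) - q ^ c) := by
    simp only [P, Nat.cast_prod, Z]
    rw [Fin.prod_univ_castSucc]
    congr 1
    · apply Finset.prod_congr rfl
      intro i _
      rw [hpow _ _ (by simp; omega)]
      simp
    · rw [hpow _ _ (by simp)]
      simp
  have hP2 : ((∏ i : Fin (c + 1), (q ^ (c + 1 + t) - q ^ (i : ℕ)) : ℕ) : ℤ) =
      Z * ((q : ℤ) ^ c * ((q : ℤ) ^ (c + 1 + t) - 1)) := by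
    rw [Nat.cast_prod, Fin.prod_univ_succ, hpow _ _ (by simp)]
    have : ∏ i : Fin c, ((q ^ (c + 1 + t) - q ^ (i.succ : ℕ) : ℕ) : ℤ) = (q : ℤ) ^ c * Z := by
      have hc : (q : ℤ) ^ c = ∏ i : Fin c, (q : ℤ) := by simp
      rw [hc, ← Finset.prod_mul_distrib]
      apply Finset.prod_congr rfl
      intro i _
      rw [hpow _ _ (by simp; omega), Fin.val_succ]
      ring
    rw [this]
    simp only [Fin.val_zero, pow_zero]
    ring
  have hg : ∀ k, ((q : ℤ) - 1) * gNum q k = (q : ℤ) ^ k - 1 := by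
    intro k
    induction k with
    | zero => simp [gNum]
    | succ k ih => rw [gNum_succ]; push_cast; linear_combination ih
  refine ⟨∑ s ∈ I, w s, P, Z * (q : ℤ) ^ c * ((q : ℤ) ^ (c + 1) - 1), ?_, ?_, ?_, ?_, ?_⟩
  · apply Finset.prod_pos
    intro i _
    have : q ^ (i : ℕ) < q ^ (c + t) := Nat.pow_lt_pow_right hq1 (by omega)
    omega
  · exact AddSubmonoid.sum_mem _ fun s hs => AddSubmonoid.subset_closure (hw s hs)
  · rintro x ⟨W, hW, rfl⟩
    let b := Module.finBasisOfFinrankEq F W hW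
    let s0 : Fin (c + 1) → V := fun i => (b i : V)
    have hs0 : s0 ∈ I := by
      rw [Finset.mem_filter]
      exact ⟨Finset.mem_univ _, b.linearIndependent.map' W.subtype W.ker_subtype⟩
    have hspan : Submodule.span F (Set.range s0) = W := by
      have e : Set.range s0 = W.subtype '' Set.range b := by
        rw [← Set.range_comp]; rfl
      rw [e, Submodule.span_image, b.span_eq, Submodule.map_top, Submodule.range_subtype]
    have hws : w s0 = om W := by simp only [w, hspan]
    rw [← Finset.add_sum_erase I w hs0, hws, add_sub_cancel_left]
    exact AddSubmonoid.sum_mem _ fun s hs =>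
      AddSubmonoid.subset_closure (hw s (Finset.mem_of_mem_erase hs))
  · funext f
    rw [hval]
    by_cases hf : f = 0
    · subst hf
      have hk : finrank F (LinearMap.ker (0 : Dual F V)) = c + 1 + t := by
        rw [LinearMap.ker_zero, finrank_top, hV]
      rw [card_li q hq _ _ (by rw [hk]; omega), hk, hP2]
      simp only [Pi.add_apply, Pi.smul_apply, om_zero, smul_eq_mul, hP]
      ring
    · have hk : finrank F (LinearMap.ker f) = c + t := by
        have := Module.Dual.finrank_ker_add_one_of_ne_zero hf
        omega
      rw [card_li q hq _ _ (by rw [hk]; omega), hk]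
      simp only [Pi.add_apply, Pi.smul_apply, om_bot, om_top f hf, smul_eq_mul]
      simp [P]
  · rw [hP]
    have h1 := hg (c + 1)
    have h2 := hg t
    rw [← h1]
    have : (q : ℤ) ^ (c + t) - q ^ c = q ^ c * ((q - 1) * gNum q t) := by rw [h2]; ring
    rw [this]
    ring

theorem absorb (h : ℕ) (J : Dual F V → ℤ) (hJ : J ∈ AddSubmonoid.closure (gens F V h))
    (hJ2 : ∀ x ∈ gens F V h, J - x ∈ AddSubmonoid.closure (gens F V h))
    (l : Dual F V → ℤ) (hl : l ∈ AddSubgroup.closure (gens F V h)) :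
    ∃ K : ℕ, K • J + l ∈ AddSubmonoid.closure (gens F V h) ∧
      K • J - l ∈ AddSubmonoid.closure (gens F V h) := by
  induction hl using AddSubgroup.closure_induction with
  | mem x hx =>
    refine ⟨1, ?_, ?_⟩
    · rw [one_smul]; exact AddSubmonoid.add_mem _ hJ (AddSubmonoid.subset_closure hx)
    · rw [one_smul]; exact hJ2 x hx
  | zero => exact ⟨0, by simp, by simp⟩
  | add x y _ _ hx hy =>
    obtain ⟨K, h1, h2⟩ := hx
    obtain ⟨K', h3, h4⟩ := hy
    refine ⟨K + K', ?_, ?_⟩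
    · convert AddSubmonoid.add_mem _ h1 h3 using 1
      rw [add_smul]; abel
    · convert AddSubmonoid.add_mem _ h2 h4 using 1
      rw [add_smul]; abel
  | neg x _ hx =>
    obtain ⟨K, h1, h2⟩ := hx
    refine ⟨K, ?_, ?_⟩
    · rwa [← sub_eq_add_neg]
    · rwa [sub_neg_eq_add]

theorem absorb2 (h : ℕ) (J : Dual F V → ℤ) (hJ : J ∈ AddSubmonoid.closure (gens F V h))
    (hJ2 : ∀ x ∈ gens F V h, J - x ∈ AddSubmonoid.closure (gens F V h))
    (M : ℕ) (l : Dual F V → ℤ) (hl : l ∈ AddSubgroup.closure (gens F V h)) :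
    ∃ K : ℕ, ∀ c : ℤ, |c| ≤ M → K • J + c • l ∈ AddSubmonoid.closure (gens F V h) := by
  obtain ⟨K, h1, h2⟩ := absorb h J hJ hJ2 l hl
  refine ⟨M * K, fun c hc => ?_⟩
  obtain ⟨n, rfl | rfl⟩ := Int.eq_nat_or_neg c
  · obtain ⟨k, rfl⟩ : ∃ k, M = n + k := ⟨M - n, by simp at hc; omega⟩
    have := AddSubmonoid.add_mem _ (AddSubmonoid.nsmul_mem _ h1 n)
      (AddSubmonoid.nsmul_mem _ hJ (k * K))
    convert this using 1
    funext f
    simp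
    ring
  · obtain ⟨k, rfl⟩ : ∃ k, M = n + k := ⟨M - n, by simp at hc; omega⟩
    have := AddSubmonoid.add_mem _ (AddSubmonoid.nsmul_mem _ h2 n)
      (AddSubmonoid.nsmul_mem _ hJ (k * K))
    convert this using 1
    funext f
    simp
    ring

theorem absorb_sum (h : ℕ) (J : Dual F V → ℤ) (hJ : J ∈ AddSubmonoid.closure (gens F V h))
    (hJ2 : ∀ x ∈ gens F V h, J - x ∈ AddSubmonoid.closure (gens F V h))
    (M t : ℕ) (l : ℕ → Dual F V → ℤ) (hl : ∀ i < t, l i ∈ AddSubgroup.closure (gens F V h)) :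
    ∃ K : ℕ, ∀ c : ℕ → ℤ, (∀ i < t, |c i| ≤ M) →
      K • J + ∑ i ∈ Finset.range t, c i • l i ∈ AddSubmonoid.closure (gens F V h) := by
  induction t with
  | zero => exact ⟨0, by simp⟩
  | succ t ih =>
    obtain ⟨K, hK⟩ := ih fun i hi => hl i (by omega)
    obtain ⟨K', hK'⟩ := absorb2 h J hJ hJ2 M (l t) (hl t (by omega))
    refine ⟨K + K', fun c hc => ?_⟩
    convert AddSubmonoid.add_mem _ (hK c fun i hi => hc i (by omega)) (hK' (c t) (hc t (by omega)))
      using 1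
    rw [Finset.sum_range_succ, add_smul]
    abel

theorem tele1 (q t : ℕ) (c : ℕ → ℤ) :
    ∑ i ∈ Finset.range t, (q * c (i + 1) - c i) * (gNum q i : ℤ) =
      c t * gNum q t - ∑ i ∈ Finset.range t, c (i + 1) := by
  induction t with
  | zero => simp [gNum]
  | succ t ih =>
    rw [Finset.sum_range_succ, ih, Finset.sum_range_succ, gNum_succ']
    push_cast
    ring

theorem tele2 (q t : ℕ) (c : ℕ → ℤ) :
    ∑ i ∈ Finset.range t, (q * c (i + 1) - c i) * (q : ℤ) ^ i = c t * (q : ℤ) ^ t - c 0 := by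
  induction t with
  | zero => simp
  | succ t ih =>
    rw [Finset.sum_range_succ, ih]
    ring

theorem construct (q : ℕ) (hq : q = Fintype.card F) (h t : ℕ) (hh : 1 ≤ h) (ht : 1 ≤ t)
    (hV : finrank F V = h + t) :
    ∃ s₀ : ℕ, ∀ s, s₀ ≤ s → ∀ (m e : ℕ) (c : ℕ → ℕ), c 0 = m → (∀ i, c i ≤ q * c (i + 1)) →
      (∀ i, q * c (i + 1) < c i + q) → gNum q h * s = ∑ j ∈ Finset.range t, c (j + 1) + e →
      e < t →
      ∃ G ∈ AddSubmonoid.closure (gens F V h), G 0 = s + m ∧ ∀ f, f ≠ 0 → G f ≤ s := by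
  obtain ⟨J, P, u, hP, hJ, hJ2, hJe, hPu⟩ := exists_J (F := F) (V := V) q hq h t hh ht hV
  obtain ⟨A0, -, -, hA0⟩ := exists_submodule_between (⊥ : Submodule F V) ⊤ le_top (h - 1)
    (by rw [finrank_top, finrank_bot, hV]; omega)
  rw [finrank_bot, zero_add] at hA0
  have hB : ∀ i, ∃ B : Submodule F V, i ≤ t → A0 ≤ B ∧ finrank F B = h + i := by
    intro i
    by_cases hi : i ≤ t
    · obtain ⟨B, h1, _, h2⟩ := exists_submodule_between A0 ⊤ le_top (i + 1)
        (by rw [finrank_top, hA0, hV]; omega)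
      exact ⟨B, fun _ => ⟨h1, by omega⟩⟩
    · exact ⟨⊥, fun h' => absurd h' hi⟩
  choose B hB using hB
  have hl0 := (rel_0 q hq h A0 (B 1) (hB 1 ht).1 (by omega) (hB 1 ht).2 h).1 ⊥ bot_le
    (by rw [finrank_bot]; omega)
  have hli : ∀ i < t, (q ^ i : ℤ) • om (B i) + (gNum q i : ℤ) • om A0 ∈
      AddSubgroup.closure (gens F V h) := fun i hi =>
    rel_i q hq h i A0 (B i) (hB i hi.le).1 (by omega) (hB i hi.le).2
  have hlt := rel_i q hq h t A0 ⊤ le_top (by omega) (by rw [finrank_top, hV])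
  let M := P * gNum q h + q * (∑ i ∈ Finset.range t, gNum q i) + 2 * t + q + P + t * q
  obtain ⟨K0, hK0⟩ := absorb2 h J hJ hJ2 M _ hl0
  obtain ⟨K1, hK1⟩ := absorb_sum h J hJ hJ2 M t
    (fun i => (q ^ i : ℤ) • om (B i) + (gNum q i : ℤ) • om A0) hli
  obtain ⟨K2, hK2⟩ := absorb2 h J hJ hJ2 M _ (hli (t - 1) (by omega))
  obtain ⟨K3, hK3⟩ := absorb2 h J hJ hJ2 M _ hlt
  refine ⟨P * (K0 + K1 + K2 + K3), ?_⟩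
  intro s hs m e c hc0 hc1 hc2 hsum he
  have hdm := Nat.div_add_mod s P
  have hml := Nat.mod_lt s hP
  have hAK : K0 + K1 + K2 + K3 ≤ s / P := by
    rw [Nat.le_div_iff_mul_le hP]; linarith
  generalize s / P = A at hdm hAK
  generalize s % P = s' at hdm hml
  let b : ℕ → ℤ := fun i => q * c (i + 1) - c i
  have hb0 : ∀ i, 0 ≤ b i := fun i => by
    have := hc1 i
    simp only [b]; zify at this; linarith
  have hb1 : ∀ i, b i ≤ q := fun i => by
    have := hc2 i
    simp only [b]; zify at this; linarith
  have ht1 := tele1 q t (fun i => (c i : ℤ))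
  have ht2 := tele2 q t (fun i => (c i : ℤ))
  change ∑ i ∈ Finset.range t, b i * (gNum q i : ℤ) = _ at ht1
  change ∑ i ∈ Finset.range t, b i * (q : ℤ) ^ i = _ at ht2
  have hsum' : (gNum q h : ℤ) * s = ∑ j ∈ Finset.range t, (c (j + 1) : ℤ) + e := by
    exact_mod_cast hsum
  have hdm' : (P : ℤ) * A + s' = s := by exact_mod_cast hdm
  let c' : ℤ := c t - A * u
  have hc' : c' * gNum q t = s' * gNum q h + ∑ i ∈ Finset.range t, b i * (gNum q i : ℤ) - e := by
    simp only [c']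
    rw [ht1]
    linear_combination (A : ℤ) * hPu - hsum' - (gNum q h : ℤ) * hdm'
  have hgt : 1 ≤ gNum q t := by
    obtain ⟨k, rfl⟩ : ∃ k, t = k + 1 := ⟨t - 1, by omega⟩
    rw [gNum_succ']; omega
  have hbs : ∑ i ∈ Finset.range t, b i * (gNum q i : ℤ) ≤
      q * ∑ i ∈ Finset.range t, (gNum q i : ℤ) := by
    rw [Finset.mul_sum]
    exact Finset.sum_le_sum fun i _ => mul_le_mul_of_nonneg_right (hb1 i) (by positivity)
  have hbs0 : 0 ≤ ∑ i ∈ Finset.range t, b i * (gNum q i : ℤ) :=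
    Finset.sum_nonneg fun i _ => mul_nonneg (hb0 i) (by positivity)
  have hs'P : (s' : ℤ) * gNum q h ≤ P * gNum q h := by
    apply mul_le_mul_of_nonneg_right _ (by positivity)
    exact_mod_cast hml.le
  have hMe : (M : ℤ) = P * gNum q h + q * (∑ i ∈ Finset.range t, (gNum q i : ℤ)) + 2 * t + q + P
      + t * q := by
    simp only [M]; push_cast; rfl
  have hpos1 : (0 : ℤ) ≤ q * ∑ i ∈ Finset.range t, (gNum q i : ℤ) := hbs0.trans hbs
  have hpos2 : (0 : ℤ) ≤ P * gNum q h := by positivity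
  have hpos3 : (0 : ℤ) ≤ t * q := by positivity
  have het : (e : ℤ) < t := by exact_mod_cast he
  have hq0 : (0 : ℤ) ≤ q := by positivity
  have hs'0 : (0 : ℤ) ≤ s' := by positivity
  have hs'1 : (s' : ℤ) < P := by exact_mod_cast hml
  have he0 : (0 : ℤ) ≤ e := by positivity
  have hs'h : (0 : ℤ) ≤ s' * gNum q h := by positivity
  have hcabs : |c'| ≤ P * gNum q h + q * (∑ i ∈ Finset.range t, (gNum q i : ℤ)) + t := by
    have h1 : |c'| ≤ |c' * gNum q t| := by
      rw [abs_mul]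
      apply le_mul_of_one_le_right (abs_nonneg _)
      rw [Nat.abs_cast]
      exact_mod_cast hgt
    refine h1.trans ?_
    rw [hc', abs_le]
    constructor <;> linarith
  rw [abs_le] at hcabs
  have k0 := hK0 s' (by rw [abs_le]; constructor <;> linarith)
  have k1 := hK1 (fun i => - b i) (by
    intro i _
    have := hb0 i
    have := hb1 i
    rw [abs_le]; constructor <;> linarith)
  have k2 := hK2 (-(e * q)) (by
    have h1 : (e : ℤ) * q ≤ t * q := mul_le_mul_of_nonneg_right het.le hq0
    have h2 : (0 : ℤ) ≤ e * q := by positivity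
    rw [abs_le]; constructor <;> linarith)
  have k3 := hK3 (c' + e) (by rw [abs_le]; constructor <;> linarith)
  obtain ⟨R, rfl⟩ := Nat.exists_eq_add_of_le hAK
  have k4 := AddSubmonoid.nsmul_mem _ hJ R
  have kk := AddSubmonoid.add_mem _ (AddSubmonoid.add_mem _ (AddSubmonoid.add_mem _
    (AddSubmonoid.add_mem _ k0 k1) k2) k3) k4
  have hgt' : (gNum q t : ℤ) = q * gNum q (t - 1) + 1 := by
    obtain ⟨k, rfl⟩ : ∃ k, t = k + 1 := ⟨t - 1, by omega⟩
    rw [gNum_succ']; push_cast; rfl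
  have hqt : (q : ℤ) ^ t = q * q ^ (t - 1) := by
    obtain ⟨k, rfl⟩ : ∃ k, t = k + 1 := ⟨t - 1, by omega⟩
    rw [pow_succ']; rfl
  refine ⟨_, kk, ?_⟩
  have hval : ∀ f : Dual F V, (((K0 • J + (s' : ℤ) • (om ⊥ - (gNum q h : ℤ) • om A0)) +
        (K1 • J + ∑ i ∈ Finset.range t, (-b i) • ((q ^ i : ℤ) • om (B i) + (gNum q i : ℤ) • om A0))
        + (K2 • J + (-(e * q : ℤ)) • ((q ^ (t - 1) : ℤ) • om (B (t - 1)) +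
          (gNum q (t - 1) : ℤ) • om A0))
        + (K3 • J + (c' + e) • ((q ^ t : ℤ) • om ⊤ + (gNum q t : ℤ) • om A0)) + R • J : Dual F V → ℤ) f) =
        (s : ℤ) * om (⊥ : Submodule F V) f
      - ∑ i ∈ Finset.range t, b i * ((q : ℤ) ^ i * om (B i) f)
      - e * (q ^ t * om (B (t - 1)) f) + (c t + e) * (q ^ t * om (⊤ : Submodule F V) f) := by
    intro f
    have hs1 : ∑ i ∈ Finset.range t, -b i * ((q : ℤ) ^ i * om (B i) f + gNum q i * om A0 f) =
        - ∑ i ∈ Finset.range t, b i * ((q : ℤ) ^ i * om (B i) f)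
        - (∑ i ∈ Finset.range t, b i * (gNum q i : ℤ)) * om A0 f := by
      rw [Finset.sum_mul, ← Finset.sum_neg_distrib, ← Finset.sum_sub_distrib]
      apply Finset.sum_congr rfl
      intro i _
      ring
    have hJf : J f = P * om (⊥ : Submodule F V) f + ((q : ℤ) ^ t * u) * om ⊤ f := by
      rw [hJe]; simp
    simp only [Pi.add_apply, Pi.smul_apply, Pi.sub_apply, Finset.sum_apply, smul_eq_mul,
      nsmul_eq_mul, Pi.mul_apply, Pi.natCast_apply, hs1, hJf]
    simp only [c'] at hc' ⊢
    push_cast at hc' hdm' ⊢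
    linear_combination (om (⊥ : Submodule F V) f) * hdm' + (om A0 f) * hc' +
      (e : ℤ) * (om A0 f) * hgt' + (e : ℤ) * om (B (t - 1)) f * hqt
  constructor
  · rw [hval]
    simp only [om_zero, mul_one]
    rw [ht2, hc0]
    ring
  · intro f hf
    rw [hval, om_bot, om_top f hf]
    have h1 : 0 ≤ ∑ i ∈ Finset.range t, b i * ((q : ℤ) ^ i * om (B i) f) :=
      Finset.sum_nonneg fun i _ => mul_nonneg (hb0 i) (mul_nonneg (by positivity) (om_nonneg _ _))
    have h2 : 0 ≤ (e : ℤ) * (q ^ t * om (B (t - 1)) f) :=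
      mul_nonneg (by positivity) (mul_nonneg (by positivity) (om_nonneg _ _))
    linarith

theorem to_multiset (h : ℕ) (G : Dual F V → ℤ) (hG : G ∈ AddSubmonoid.closure (gens F V h)) :
    ∃ S : Multiset (Submodule F V), (∀ W ∈ S, finrank F W = h) ∧
      ∀ f, G f = cnt S (LinearMap.ker f) := by
  induction hG using AddSubmonoid.closure_induction with
  | mem x hx =>
    obtain ⟨W, hW, rfl⟩ := hx
    refine ⟨{W}, by simpa using hW, fun f => ?_⟩
    simp only [om, cnt, ← Multiset.cons_zero, Multiset.countP_cons, Multiset.countP_zero, zero_add]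
    split_ifs <;> simp
  | zero => exact ⟨0, by simp, by simp [cnt]⟩
  | add x y _ _ hx hy =>
    obtain ⟨S, h1, h2⟩ := hx
    obtain ⟨S', h3, h4⟩ := hy
    refine ⟨S + S', ?_, ?_⟩
    · intro W hW
      rcases Multiset.mem_add.1 hW with h | h
      · exact h1 W h
      · exact h3 W h
    · intro f
      simp only [Pi.add_apply, h2, h4, cnt, Multiset.countP_add]
      push_cast
      rfl

end construction

theorem statement1 (F : Type*) [Field F] [Fintype F] (q r h : ℕ)
    (hq : q = Fintype.card F) (hh : 1 ≤ h) (hhr : h < r) :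
    ∃ s₀ : ℕ, ∀ s : ℕ, s₀ ≤ s →
      ∃ N : ℕ,
        -- `N` is the largest integer `n` with `[h]_q·n ≥ g_q(r, q^(h-1)·(n-s))`
        IsGreatest {n : ℕ | griesmer q r (q ^ (h - 1) * (n - s)) ≤ gNum q h * n} N ∧
        -- and `n_q(r,h;s) = N`
        IsGreatest {n : ℕ | ∃ S : Multiset (Submodule F (Fin r → F)),
          Multiset.card S = n ∧ (∀ W ∈ S, Module.finrank F W ≤ h) ∧
          ∀ H : Submodule F (Fin r → F), Module.finrank F H = r - 1 → cnt S H ≤ s} N := by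
  obtain ⟨t, rfl⟩ : ∃ t, r = h + t := ⟨r - h, by omega⟩
  have ht : 1 ≤ t := by omega
  have hq1 : 1 < q := hq ▸ Fintype.one_lt_card
  have hV : finrank F (Fin (h + t) → F) = h + t := by simp
  obtain ⟨s₀, hs₀⟩ := construct (F := F) (V := Fin (h + t) → F) q hq h t hh ht hV
  refine ⟨s₀, fun s hs => ?_⟩
  let C : ℕ → ℕ := fun m => ∑ j ∈ Finset.range t, (m + q ^ (j + 1) - 1) / q ^ (j + 1)
  have hiff : ∀ m, griesmer q (h + t) (q ^ (h - 1) * (s + m - s)) ≤ gNum q h * (s + m) ↔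
      C m ≤ gNum q h * s := by
    intro m
    rw [Nat.add_sub_cancel_left, griesmer_eq q h t m (by omega) hh, mul_add]
    change _ + C m ≤ _ ↔ _
    omega
  have hCbd : ∀ m, C m ≤ gNum q h * s → m ≤ q * (gNum q h * s) := by
    intro m hm
    rw [← cd_le_iff _ _ _ (by omega)]
    refine le_trans ?_ hm
    have := Finset.single_le_sum (f := fun j => (m + q ^ (j + 1) - 1) / q ^ (j + 1))
      (s := Finset.range t) (fun _ _ => Nat.zero_le _) (Finset.mem_range.2 ht)
    simpa using this
  have hC0 : C 0 ≤ gNum q h * s := by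
    have : C 0 = 0 := by
      apply Finset.sum_eq_zero
      intro j _
      apply cd_eq _ _ _ (by positivity)
      simp
    omega
  let m := Nat.findGreatest (fun m => C m ≤ gNum q h * s) (q * (gNum q h * s))
  have hm : C m ≤ gNum q h * s :=
    Nat.findGreatest_spec (P := fun m => C m ≤ gNum q h * s) (Nat.zero_le _) hC0
  have hmax : ∀ m', C m' ≤ gNum q h * s → m' ≤ m := fun m' hm' =>
    Nat.le_findGreatest (P := fun m => C m ≤ gNum q h * s) (hCbd m' hm') hm'
  have hup : ∀ n, griesmer q (h + t) (q ^ (h - 1) * (n - s)) ≤ gNum q h * n → n ≤ s + m := by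
    intro n hn
    by_cases hns : n ≤ s
    · omega
    · obtain ⟨k, rfl⟩ := Nat.exists_eq_add_of_le (Nat.le_of_not_le hns)
      have := hmax k ((hiff k).1 hn)
      omega
  have hlip : C (m + 1) ≤ C m + t := by
    have : C m + t = ∑ j ∈ Finset.range t, ((m + q ^ (j + 1) - 1) / q ^ (j + 1) + 1) := by
      rw [Finset.sum_add_distrib]; simp [C]
    rw [this]
    apply Finset.sum_le_sum
    intro j _
    have hp : 0 < q ^ (j + 1) := by positivity
    have := (cd_le_iff m (q ^ (j + 1)) _ hp).1 le_rfl
    rw [cd_le_iff _ _ _ hp, mul_add]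
    omega
  have hgt : gNum q h * s < C (m + 1) := by
    by_contra hcon
    have := hmax (m + 1) (by omega)
    omega
  refine ⟨s + m, ⟨(hiff m).2 hm, fun n hn => hup n hn⟩, ?_, ?_⟩
  · have hceil : ∀ i, m ≤ q ^ i * ((m + q ^ i - 1) / q ^ i) := fun i =>
      (cd_le_iff m (q ^ i) _ (by positivity)).1 le_rfl
    obtain ⟨G, hG, hG0, hGf⟩ := hs₀ s hs m (gNum q h * s - C m)
      (fun i => (m + q ^ i - 1) / q ^ i) (by simp)
      (by
        intro i
        rw [cd_le_iff _ _ _ (by positivity), ← mul_assoc, ← pow_succ]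
        exact hceil (i + 1))
      (by
        intro i
        have h1 : (m + q ^ (i + 1) - 1) / q ^ (i + 1) ≤ ((m + q ^ i - 1) / q ^ i + q - 1) / q := by
          rw [cd_le_iff _ _ _ (by positivity), pow_succ, mul_assoc]
          refine (hceil i).trans (Nat.mul_le_mul_left _ ?_)
          exact (cd_le_iff _ q _ (by omega)).1 le_rfl
        change q * ((m + q ^ (i + 1) - 1) / q ^ (i + 1)) < (m + q ^ i - 1) / q ^ i + q
        have h2 := Nat.mul_le_mul_left q h1
        have h3 := Nat.mul_div_le ((m + q ^ i - 1) / q ^ i + q - 1) q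
        have h4 := h2.trans h3
        generalize (m + q ^ i - 1) / q ^ i = x at h4 ⊢
        generalize q * ((m + q ^ (i + 1) - 1) / q ^ (i + 1)) = y at h4 ⊢
        omega)
      (by change _ = C m + _; omega) (by omega)
    obtain ⟨S, hS, hSf⟩ := to_multiset h G hG
    refine ⟨S, ?_, fun W hW => (hS W hW).le, ?_⟩
    · have := hSf 0
      rw [hG0] at this
      have h2 : cnt S (LinearMap.ker (0 : Dual F (Fin (h + t) → F))) = Multiset.card S := by
        unfold cnt
        rw [Multiset.countP_eq_card]
        intro W _
        simp
      rw [h2] at this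
      exact_mod_cast this.symm
    · intro H hH
      have hlt : H < ⊤ := by
        rw [lt_top_iff_ne_top]
        rintro rfl
        rw [finrank_top, hV] at hH
        omega
      obtain ⟨f, hf, hle⟩ := Submodule.exists_le_ker_of_lt_top H hlt
      have hk := Module.Dual.finrank_ker_add_one_of_ne_zero (K := F) hf
      have heq : H = LinearMap.ker f := Submodule.eq_of_le_of_finrank_eq hle (by omega)
      have h1 := hGf f hf
      rw [hSf f, ← heq] at h1
      exact_mod_cast h1
  · rintro n ⟨S, hn, hS, hH⟩
    exact hup n (upper_bound q h (h + t) s n hq hh hhr hV S hn hS hH)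
end
end

section
/- Let q be a prime power, let r ≥ h ≥ 1 be integers and set g := gcd(r,h). Then there exists a multiset 𝒮 of h-dimensional subspaces of F_q^r of cardinality [r]_q/[g]_q such that every point of F_q^r is contained in exactly [h]_q/[g]_q elements of 𝒮 and every hyperplane of F_q^r contains exactly [r−h]_q/[g]_q elements of 𝒮 (all counted with multiplicity); in particular, a faithful projective h-([r]_q/[g]_q, r, [r−h]_q/[g]_q, [h]_q/[g]_q)_q system exists. -/
open scoped Classical

noncomputable section

theorem aux_arith (q a g c : ℕ) (hq : 2 ≤ q) (hg : 1 ≤ g)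
    (h : c * (q ^ g - 1) = q ^ a - 1) : c = gNum q a / gNum q g := by
  have key : ∀ i, gNum q i * (q - 1) = q ^ i - 1 := fun i =>
    geom_sum_mul_of_one_le (by omega) i
  have hpos : 0 < gNum q g := by
    unfold gNum
    exact Finset.sum_pos (fun _ _ => by positivity) ⟨0, by simp; omega⟩
  rw [← key, ← key, ← mul_assoc] at h
  have h2 := Nat.eq_of_mul_eq_mul_right (by omega) h
  rw [← h2, Nat.mul_div_cancel _ hpos]

theorem aux_quot {G : Type*} [Group G] [Finite G] (N : Subgroup G) (P : G → Prop)
    (hP : ∀ g, ∀ n ∈ N, P (g * n) ↔ P g) :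
    Nat.card {x : G ⧸ N // P x.out} * Nat.card N = Nat.card {g // P g} := by
  rw [← Nat.card_prod]
  refine Nat.card_congr (Equiv.ofBijective
    (fun y => ⟨y.1.1.out * y.2, (hP _ _ y.2.2).2 y.1.2⟩) ⟨?_, ?_⟩)
  · rintro ⟨⟨x, hx⟩, n, hn⟩ ⟨⟨y, hy⟩, m, hm⟩ h
    simp only [Subtype.mk.injEq] at h
    have hxy : x = y := by
      have := congrArg (QuotientGroup.mk (s := N)) h
      rwa [QuotientGroup.mk_mul_of_mem _ hn, QuotientGroup.mk_mul_of_mem _ hm,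
        QuotientGroup.out_eq', QuotientGroup.out_eq'] at this
    subst hxy
    have := mul_left_cancel h
    subst this
    rfl
  · rintro ⟨g, hg⟩
    have hn : ((QuotientGroup.mk g : G ⧸ N).out)⁻¹ * g ∈ N := by
      rw [← QuotientGroup.eq, QuotientGroup.out_eq']
    refine ⟨⟨⟨QuotientGroup.mk g, ?_⟩, ⟨_, hn⟩⟩, ?_⟩
    · have := hP (QuotientGroup.mk g : G ⧸ N).out _ hn
      rw [mul_inv_cancel_left] at this
      exact this.1 hg
    · simp

theorem aux_units {F L : Type*} [Field F] [Fintype F] [Field L] [Finite L] [Algebra F L]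
    (A : Submodule F L) :
    Nat.card {u : Lˣ // (u : L) ∈ A} = Fintype.card F ^ Module.finrank F A - 1 := by
  have h1 : Nat.card A = Fintype.card F ^ Module.finrank F A := by
    rw [Module.natCard_eq_pow_finrank (K := F), Nat.card_eq_fintype_card]
  have e : {u : Lˣ // (u : L) ∈ A} ≃ {a : A // a ≠ 0} :=
    { toFun := fun u => ⟨⟨u.1, u.2⟩, by
        intro h
        exact u.1.ne_zero (congrArg Subtype.val h)⟩
      invFun := fun a => ⟨Units.mk0 a.1.1 (fun h => a.2 (Subtype.ext h)), a.1.2⟩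
      left_inv := fun u => by ext; rfl
      right_inv := fun a => by ext; rfl }
  rw [Nat.card_congr e, ← h1]
  have : Fintype A := Fintype.ofFinite A
  rw [Nat.card_eq_fintype_card, Nat.card_eq_fintype_card]
  exact Set.card_ne_eq (0 : A)

theorem aux_countP {ι α : Type*} [Fintype ι] (f : ι → α) (P : α → Prop) :
    Multiset.countP P (Finset.univ.val.map f) = Nat.card {i // P (f i)} := by
  rw [Multiset.countP_map, Nat.card_eq_fintype_card, Fintype.card_subtype]
  rfl

/-- the dilate of `W` by `u`, moved to `V` -/
def aux_dil {F L V : Type*} [Field F] [Field L] [Algebra F L] [AddCommGroup V] [Module F V]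
    (e : L ≃ₗ[F] V) (W : Submodule F L) (u : Lˣ) : Submodule F V :=
  W.comap ((LinearMap.mulLeft F (u : L)) ∘ₗ e.symm.toLinearMap)

theorem aux_dil_finrank {F L V : Type*} [Field F] [Field L] [Algebra F L] [AddCommGroup V]
    [Module F V] (e : L ≃ₗ[F] V) (W : Submodule F L) (u : Lˣ) :
    Module.finrank F (aux_dil e W u) = Module.finrank F W := by
  have hb : Function.Bijective ((LinearMap.mulLeft F (u : L)) ∘ₗ e.symm.toLinearMap) := by
    have : Function.Bijective (fun x : L => (u : L) * x) := Units.mulLeft_bijective u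
    exact this.comp e.symm.bijective
  let E := LinearEquiv.ofBijective _ hb
  have : aux_dil e W u = W.map E.symm.toLinearMap := by
    rw [Submodule.map_equiv_eq_comap_symm]; rfl
  rw [this]
  exact LinearEquiv.finrank_map_eq E.symm W

theorem aux_hyper {F L : Type*} [Field F] [Field L] [Algebra F L] [FiniteDimensional F L]
    (W H : Submodule F L) (hH : Module.finrank F H + 1 = Module.finrank F L) :
    ∃ A : Submodule F L, Module.finrank F A = Module.finrank F L - Module.finrank F W ∧
      ∀ a, a ∈ A ↔ ∀ w ∈ W, a * w ∈ H := by
  have hlt : H < ⊤ := by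
    rw [lt_top_iff_ne_top]
    rintro rfl
    rw [finrank_top] at hH
    omega
  obtain ⟨φ, hφ, hle⟩ := H.exists_le_ker_of_lt_top hlt
  have hker : H = LinearMap.ker φ := by
    apply Submodule.eq_of_le_of_finrank_le hle
    have h1 := φ.finrank_range_add_finrank_ker
    have h2 : 0 < Module.finrank F (LinearMap.range φ) := by
      rw [Nat.pos_iff_ne_zero, Ne, Submodule.finrank_eq_zero, LinearMap.range_eq_bot]
      exact hφ
    omega
  let B : LinearMap.BilinForm F L := (LinearMap.mul F L).compr₂ φ
  have hB : ∀ x y, B x y = φ (x * y) := fun x y => rfl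
  have hsymm : ∀ x y, B x y = B y x := fun x y => by rw [hB, hB, mul_comm]
  have hrefl : B.IsRefl := fun x y h => by rw [hsymm]; exact h
  have hl : ∀ x, (∀ y, B x y = 0) → x = 0 := by
    intro x hx
    by_contra hx0
    apply hφ
    ext y
    have := hx (x⁻¹ * y)
    rwa [hB, mul_inv_cancel_left₀ hx0] at this
  have hnd : B.Nondegenerate := by
    refine ⟨hl, fun x hx => hl x fun y => ?_⟩
    rw [hsymm]; exact hx y
  refine ⟨B.orthogonal W, LinearMap.BilinForm.finrank_orthogonal hnd W, fun a => ?_⟩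
  rw [LinearMap.BilinForm.mem_orthogonal_iff]
  refine forall₂_congr fun w _ => ?_
  rw [hker, LinearMap.mem_ker, mul_comm]
  rfl

theorem aux_core {F K L V : Type*} [Field F] [Fintype F] [Field K] [Finite K] [Field L] [Finite L]
    [Algebra F K] [Algebra K L] [Algebra F L] [IsScalarTower F K L] [AddCommGroup V] [Module F V]
    (e : L ≃ₗ[F] V) (k : ℕ) (hk : k ≤ Module.finrank K L) :
    ∃ S : Multiset (Submodule F V),
      Multiset.card S * (Fintype.card F ^ Module.finrank F K - 1)
        = Fintype.card F ^ Module.finrank F V - 1 ∧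
      (∀ W ∈ S, Module.finrank F W = Module.finrank F K * k) ∧
      (∀ P : Submodule F V, Module.finrank F P = 1 →
        mult S P * (Fintype.card F ^ Module.finrank F K - 1)
          = Fintype.card F ^ (Module.finrank F K * k) - 1) ∧
      (∀ H : Submodule F V, Module.finrank F H + 1 = Module.finrank F V →
        cnt S H * (Fintype.card F ^ Module.finrank F K - 1)
          = Fintype.card F ^ (Module.finrank F V - Module.finrank F K * k) - 1) := by
  have : FiniteDimensional F L := Module.Finite.of_finite
  have : FiniteDimensional F K := Module.Finite.of_finite
  have : FiniteDimensional K L := Module.Finite.of_finite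
  have hLV : Module.finrank F L = Module.finrank F V := e.finrank_eq
  obtain ⟨f, hf⟩ := exists_linearIndependent_of_le_finrank hk
  let W0 : Submodule K L := Submodule.span K (Set.range f)
  have hW0 : Module.finrank K W0 = k := by
    rw [finrank_span_eq_card hf, Fintype.card_fin]
  let W : Submodule F L := W0.restrictScalars F
  have hW : Module.finrank F W = Module.finrank F K * k := by
    rw [← hW0]
    exact (Module.finrank_mul_finrank F K W0).symm
  let N : Subgroup Lˣ := (Units.map (algebraMap K L : K →* L)).range
  have hN : Nat.card N = Fintype.card F ^ Module.finrank F K - 1 := by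
    have hinj : Function.Injective (Units.map (algebraMap K L : K →* L)) :=
      Units.map_injective (algebraMap K L).injective
    rw [← Nat.card_congr (MonoidHom.ofInjective hinj).toEquiv, Nat.card_units,
      Module.natCard_eq_pow_finrank (K := F), Nat.card_eq_fintype_card]
  have hmem : ∀ u v, v ∈ aux_dil e W u ↔ (u : L) * e.symm v ∈ W0 := fun u v => Iff.rfl
  have hinv : ∀ u, ∀ n ∈ N, aux_dil e W (u * n) = aux_dil e W u := by
    rintro u _ ⟨c, rfl⟩
    ext v
    rw [hmem, hmem]
    have : ((u * Units.map (algebraMap K L : K →* L) c : Lˣ) : L) * e.symm v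
        = c • ((u : L) * e.symm v) := by
      rw [Units.smul_def, Algebra.smul_def]
      simp only [Units.val_mul, Units.coe_map, MonoidHom.coe_coe]
      ring
    rw [this]
    exact Submodule.smul_mem_iff' W0 c
  have : Fintype (Lˣ ⧸ N) := Fintype.ofFinite _
  have hcount : ∀ Q : Submodule F V → Prop,
      Multiset.countP Q ((Finset.univ : Finset (Lˣ ⧸ N)).val.map fun x => aux_dil e W x.out)
        * (Fintype.card F ^ Module.finrank F K - 1) = Nat.card {u // Q (aux_dil e W u)} := by
    intro Q
    rw [aux_countP, ← hN]
    exact aux_quot N (fun u => Q (aux_dil e W u)) fun u n hn => by rw [hinv u n hn]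
  refine ⟨(Finset.univ : Finset (Lˣ ⧸ N)).val.map fun x => aux_dil e W x.out, ?_, ?_, ?_, ?_⟩
  · have h1 := hcount fun _ => True
    have h0 : ∀ (D : DecidablePred fun _ : Submodule F V => True)
        (M : Multiset (Submodule F V)), @Multiset.countP _ (fun _ => True) D M = M.card :=
      fun D M => (@Multiset.countP_eq_card _ _ D M).2 fun _ _ => trivial
    rw [h0] at h1
    refine h1.trans ?_
    rw [Nat.card_congr (Equiv.subtypeUnivEquiv fun _ => trivial), Nat.card_units, ← hLV,
      Module.natCard_eq_pow_finrank (K := F), Nat.card_eq_fintype_card]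
  · intro U hU
    obtain ⟨x, -, rfl⟩ := Multiset.mem_map.1 hU
    rw [aux_dil_finrank, hW]
  · intro P hP
    obtain ⟨⟨v, hvP⟩, hv, hspan⟩ := finrank_eq_one_iff'.1 hP
    have hv0 : v ≠ 0 := fun h => hv (Subtype.ext h)
    have hPle : ∀ X : Submodule F V, P ≤ X ↔ v ∈ X := by
      intro X
      refine ⟨fun h => h hvP, fun h w hw => ?_⟩
      obtain ⟨c, hc⟩ := hspan ⟨w, hw⟩
      have hc' : c • v = w := congrArg Subtype.val hc
      rw [← hc']
      exact X.smul_mem c h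
    unfold mult
    rw [hcount, ← hW]
    have hx : e.symm v ≠ 0 := by simpa using hv0
    rw [← aux_dil_finrank (LinearEquiv.refl F L) W (Units.mk0 _ hx), ← aux_units]
    refine Nat.card_congr (Equiv.subtypeEquivRight fun u => ?_)
    rw [hPle, hmem, mul_comm]
    rfl
  · intro H hH
    unfold cnt
    rw [hcount]
    have hHc : Module.finrank F (H.map e.symm.toLinearMap) = Module.finrank F H :=
      LinearEquiv.finrank_map_eq e.symm H
    obtain ⟨A, hA, hA'⟩ := aux_hyper W (H.map e.symm.toLinearMap) (by rw [hHc, hH, hLV])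
    rw [← hLV, ← hW, ← hA, ← aux_units]
    refine Nat.card_congr ((Equiv.inv Lˣ).subtypeEquiv fun u => ?_)
    rw [hA']
    simp only [Equiv.inv_apply, Submodule.mem_map]
    constructor
    · intro h w hw
      refine ⟨e ((u⁻¹ : Lˣ) * w), h ?_, by simp⟩
      rw [hmem]
      have hw' : w ∈ W0 := hw
      simpa using hw'
    · intro h v hv
      obtain ⟨y, hy, hy2⟩ := h _ ((hmem _ _).1 hv)
      rw [Units.inv_mul_cancel_left] at hy2
      rwa [← e.symm.injective hy2]

theorem statement3 (F : Type*) [Field F] [Fintype F] (q r h : ℕ)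
    (hq : q = Fintype.card F) (hh : 1 ≤ h) (hhr : h ≤ r) :
    ∃ S : Multiset (Submodule F (Fin r → F)),
      Multiset.card S = gNum q r / gNum q (Nat.gcd r h) ∧
      (∀ W ∈ S, Module.finrank F W = h) ∧
      (∀ P : Submodule F (Fin r → F), Module.finrank F P = 1 →
        mult S P = gNum q h / gNum q (Nat.gcd r h)) ∧
      (∀ H : Submodule F (Fin r → F), Module.finrank F H = r - 1 →
        cnt S H = gNum q (r - h) / gNum q (Nat.gcd r h)) := by
  have hg : 1 ≤ Nat.gcd r h := Nat.gcd_pos_of_pos_right r hh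
  obtain ⟨n, hn⟩ := Nat.gcd_dvd_left r h
  obtain ⟨k, hk⟩ := Nat.gcd_dvd_right r h
  generalize Nat.gcd r h = g at hg hn hk ⊢
  have hn0 : n ≠ 0 := by rintro rfl; omega
  have hkn : k ≤ n := by
    rw [hn, hk] at hhr
    exact Nat.le_of_mul_le_mul_left hhr hg
  have : NeZero g := ⟨by omega⟩
  have : NeZero n := ⟨hn0⟩
  have hq2 : 2 ≤ q := hq ▸ Fintype.one_lt_card
  obtain ⟨p, hp⟩ := CharP.exists F
  have : Fact p.Prime := ⟨CharP.char_is_prime F p⟩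
  let K := FiniteField.Extension F p g
  have : CharP K p := charP_of_injective_algebraMap (algebraMap F K).injective p
  let L := FiniteField.Extension K p n
  let : Algebra F L := ((algebraMap K L).comp (algebraMap F K)).toAlgebra
  have : IsScalarTower F K L := IsScalarTower.of_algebraMap_eq' rfl
  have hK : Module.finrank F K = g := FiniteField.finrank_extension F p g
  have hL : Module.finrank K L = n := FiniteField.finrank_extension K p n
  have : FiniteDimensional F L := Module.Finite.of_finite
  have : FiniteDimensional F K := Module.Finite.of_finite
  have hFL : Module.finrank F L = r := by
    rw [← Module.finrank_mul_finrank F K L, hK, hL, hn]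
  let e : L ≃ₗ[F] (Fin r → F) := LinearEquiv.ofFinrankEq _ _ (by rw [hFL]; simp)
  obtain ⟨S, h1, h2, h3, h4⟩ := aux_core (K := K) e k (by rw [hL]; exact hkn)
  rw [hK, ← hk] at h2 h3 h4
  rw [hK] at h1
  simp only [Module.finrank_fin_fun, ← hq, hK] at h1 h3 h4
  refine ⟨S, aux_arith _ _ _ _ hq2 hg h1, h2, fun P hP => aux_arith _ _ _ _ hq2 hg (h3 P hP),
    fun H hH => aux_arith _ _ _ _ hq2 hg (h4 H (by omega))⟩
end
end

section
/- Let q be a prime power and h ≥ 1. If q is odd then n_q(3h,h;2) = q^h + 1, and if q is even then n_q(3h,h;2) = q^h + 2. That is, the maximum n for which there exists a multiset of n subspaces of F_q^{3h}, each of dimension at most h, such that every hyperplane of F_q^{3h} contains at most 2 of them (counted with multiplicity), equals q^h + 1 when q is odd and q^h + 2 when q is even. -/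
open scoped Classical

noncomputable section

section Upper

variable {F V : Type*} [Field F] [Fintype F] [AddCommGroup V] [Module F V] [Fintype V]

lemma card_ann (W : Submodule F V) [Fintype (Module.Dual F V)] :
    (Finset.univ.filter (fun f : Module.Dual F V => W ≤ LinearMap.ker f)).card =
      Fintype.card F ^ (Module.finrank F V - Module.finrank F W) := by
  have h1 := Subspace.finrank_add_finrank_dualAnnihilator_eq W
  have h2 : Module.finrank F V - Module.finrank F W = Module.finrank F W.dualAnnihilator := by
    omega
  rw [h2, ← Module.card_eq_pow_finrank (K := F) (V := W.dualAnnihilator)]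
  rw [Fintype.card_subtype]
  congr 1
  ext f
  simp only [Finset.mem_filter, Finset.mem_univ, true_and, Submodule.mem_dualAnnihilator]
  rfl

lemma card_ann_ne (W : Submodule F V) [Fintype (Module.Dual F V)] :
    (Finset.univ.filter (fun f : Module.Dual F V => f ≠ 0 ∧ W ≤ LinearMap.ker f)).card + 1 =
      Fintype.card F ^ (Module.finrank F V - Module.finrank F W) := by
  rw [← card_ann W]
  have : (Finset.univ.filter (fun f : Module.Dual F V => f ≠ 0 ∧ W ≤ LinearMap.ker f)) =
      (Finset.univ.filter (fun f : Module.Dual F V => W ≤ LinearMap.ker f)).erase 0 := by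
    ext f; simp
  rw [this, Finset.card_erase_add_one]
  simp

lemma odd_affine (W : Submodule F V) [Fintype (Module.Dual F V)] (hq : Odd (Fintype.card F))
    (x : V) (hx : x ∉ W) :
    Odd (Finset.univ.filter (fun f : Module.Dual F V => f x = 1 ∧ W ≤ LinearMap.ker f)).card := by
  obtain ⟨f₀, hf₀, hW⟩ := Submodule.exists_le_ker_of_notMem hx
  set g : Module.Dual F V := (f₀ x)⁻¹ • f₀ with hg
  have hgx : g x = 1 := by simp [hg, hf₀]
  have hgW : ∀ w ∈ W, g w = 0 := by
    intro w hw
    have : f₀ w = 0 := hW hw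
    simp [hg, this]
  have key : (Finset.univ.filter (fun f : Module.Dual F V => f x = 1 ∧ W ≤ LinearMap.ker f)).card
      = (Finset.univ.filter (fun f : Module.Dual F V =>
          W ⊔ Submodule.span F {x} ≤ LinearMap.ker f)).card := by
    refine Finset.card_bij' (fun f _ => f - g) (fun f _ => f + g) ?_ ?_ ?_ ?_
    · intro f hf
      simp only [Finset.mem_filter, Finset.mem_univ, true_and, sup_le_iff,
        Submodule.span_singleton_le_iff_mem, LinearMap.mem_ker] at hf ⊢
      refine ⟨fun w hw => ?_, by simp [hf.1, hgx]⟩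
      have h1 : f w = 0 := hf.2 hw
      simp [h1, hgW w hw]
    · intro f hf
      simp only [Finset.mem_filter, Finset.mem_univ, true_and, sup_le_iff,
        Submodule.span_singleton_le_iff_mem, LinearMap.mem_ker] at hf ⊢
      refine ⟨by simp [hf.2, hgx], fun w hw => ?_⟩
      have h1 : f w = 0 := hf.1 hw
      simp [h1, hgW w hw]
    · intro f _; simp
    · intro f _; simp
  rw [key, card_ann]
  exact hq.pow

variable {ι : Type*} [Fintype ι] (s : ι → Submodule F V) (h : ℕ)

lemma finrank_eq_h (hV : Module.finrank F V = 3 * h) (hs : ∀ i, Module.finrank F (s i) ≤ h)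
    (H : ∀ f : Module.Dual F V, f ≠ 0 →
      (Finset.univ.filter (fun i => s i ≤ LinearMap.ker f)).card ≤ 2)
    (h3 : 3 ≤ Fintype.card ι) (i : ι) : Module.finrank F (s i) = h := by
  obtain ⟨j, hj⟩ : ∃ j, j ∉ ({i} : Finset ι) := by
    by_contra! hc
    have := Finset.card_le_card (fun x _ => hc x : Finset.univ ⊆ ({i} : Finset ι))
    simp at this; omega
  obtain ⟨k, hk⟩ : ∃ k, k ∉ ({i, j} : Finset ι) := by
    by_contra! hc
    have := Finset.card_le_card (fun x _ => hc x : Finset.univ ⊆ ({i, j} : Finset ι))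
    have h2 := Finset.card_le_two (a := i) (b := j)
    simp only [Finset.card_univ] at this; omega
  simp only [Finset.mem_singleton, Finset.mem_insert, not_or] at hj hk
  have htop : s i ⊔ s j ⊔ s k = ⊤ := by
    by_contra hne
    obtain ⟨f, hf, hle⟩ := Submodule.exists_le_ker_of_lt_top _ (lt_top_iff_ne_top.2 hne)
    have h2 : 2 < (Finset.univ.filter (fun i => s i ≤ LinearMap.ker f)).card := by
      rw [Finset.two_lt_card]
      simp only [sup_le_iff] at hle
      exact ⟨i, by simp [hle.1.1], j, by simp [hle.1.2], k, by simp [hle.2],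
        fun e => hj e.symm, fun e => hk.1 e.symm, fun e => hk.2 e.symm⟩
    exact absurd (H f hf) (by omega)
  have h1 := Submodule.finrank_add_le_finrank_add_finrank (s i ⊔ s j) (s k)
  have h2 := Submodule.finrank_add_le_finrank_add_finrank (s i) (s j)
  rw [htop, finrank_top, hV] at h1
  have := hs i; have := hs j; have := hs k
  omega

lemma upper_main (hh : 1 ≤ h) (hV : Module.finrank F V = 3 * h)
    (hs : ∀ i, Module.finrank F (s i) ≤ h)
    (H : ∀ f : Module.Dual F V, f ≠ 0 →
      (Finset.univ.filter (fun i => s i ≤ LinearMap.ker f)).card ≤ 2) :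
    Fintype.card ι ≤ Fintype.card F ^ h + 2 ∧
    (Odd (Fintype.card F) → Fintype.card ι ≠ Fintype.card F ^ h + 2) := by
  have : Finite (Module.Dual F V) := Module.finite_of_finite F
  have : Fintype (Module.Dual F V) := Fintype.ofFinite _
  set q := Fintype.card F with hq
  have hq2 : 2 ≤ q := Fintype.one_lt_card
  have hN : 2 ≤ q ^ h := hq2.trans (Nat.le_self_pow (by omega) q)
  by_cases h3 : 3 ≤ Fintype.card ι
  swap
  · constructor
    · omega
    · intro _; omega
  have hd := finrank_eq_h s h hV hs H h3
  set N := q ^ h with hNdef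
  -- nonzero functionals vanishing on `s i`
  let A : ι → Finset (Module.Dual F V) := fun i =>
    Finset.univ.filter (fun f => f ≠ 0 ∧ s i ≤ LinearMap.ker f)
  have hA : ∀ i, (A i).card + 1 = N * N := by
    intro i
    have := card_ann_ne (s i)
    rw [hd i, hV, ← hq] at this
    rw [this, hNdef, ← pow_add]; congr 1; omega
  have hsplit : ∀ i, ∀ f ∈ A i,
      ((Finset.univ.erase i).filter (fun j => s j ≤ LinearMap.ker f)).card + 1 =
      (Finset.univ.filter (fun j => s j ≤ LinearMap.ker f)).card := by
    intro i f hf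
    simp only [A, Finset.mem_filter, Finset.mem_univ, true_and] at hf
    rw [Finset.filter_erase, Finset.card_erase_add_one]
    simp [hf.2]
  have hle1 : ∀ i, ∀ f ∈ A i,
      ((Finset.univ.erase i).filter (fun j => s j ≤ LinearMap.ker f)).card ≤ 1 := by
    intro i f hf
    have h1 := hsplit i f hf
    simp only [A, Finset.mem_filter, Finset.mem_univ, true_and] at hf
    have := H f hf.1
    omega
  have hdc : ∀ i, ∑ f ∈ A i,
      ((Finset.univ.erase i).filter (fun j => s j ≤ LinearMap.ker f)).card =
      ∑ j ∈ Finset.univ.erase i, ((A i).filter (fun f => s j ≤ LinearMap.ker f)).card := by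
    intro i
    exact Finset.sum_card_bipartiteAbove_eq_sum_card_bipartiteBelow _
  have hlow : ∀ i j, N ≤ ((A i).filter (fun f => s j ≤ LinearMap.ker f)).card + 1 := by
    intro i j
    have h1 := card_ann_ne (s i ⊔ s j)
    have h2 : (A i).filter (fun f => s j ≤ LinearMap.ker f) =
        Finset.univ.filter (fun f : Module.Dual F V => f ≠ 0 ∧ s i ⊔ s j ≤ LinearMap.ker f) := by
      ext f; simp [A, and_assoc]
    rw [h2, h1, hNdef, ← hq]
    apply Nat.pow_le_pow_right (by omega)
    have h2 := Submodule.finrank_add_le_finrank_add_finrank (s i) (s j)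
    have := hs i; have := hs j
    omega
  have hlow' : ∀ i, (Fintype.card ι - 1) * (N - 1) ≤ ∑ f ∈ A i,
      ((Finset.univ.erase i).filter (fun j => s j ≤ LinearMap.ker f)).card := by
    intro i
    rw [hdc i]
    have := Finset.card_nsmul_le_sum (Finset.univ.erase i)
      (fun j => ((A i).filter (fun f => s j ≤ LinearMap.ker f)).card) (N - 1)
      (fun j _ => by have := hlow i j; omega)
    simpa [Finset.card_erase_of_mem] using this
  have hup : ∀ i, ∑ f ∈ A i,
      ((Finset.univ.erase i).filter (fun j => s j ≤ LinearMap.ker f)).card ≤ (A i).card := by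
    intro i
    have := Finset.sum_le_sum (hle1 i)
    simpa using this
  have hAN : ∀ i, (A i).card = (N + 1) * (N - 1) := by
    intro i
    have := hA i
    obtain ⟨M, hM⟩ : ∃ M, N = M + 1 := ⟨N - 1, by omega⟩
    rw [hM] at this ⊢
    simp only [Nat.add_sub_cancel]
    nlinarith
  have hι : Nonempty ι := Fintype.card_pos_iff.1 (by omega)
  obtain ⟨i₀⟩ := hι
  refine ⟨?_, ?_⟩
  · have h1 := (hlow' i₀).trans (hup i₀)
    rw [hAN] at h1
    have := Nat.le_of_mul_le_mul_right h1 (by omega)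
    omega
  · intro hodd hcard
    have hex : ∀ i, ∀ f ∈ A i,
        ((Finset.univ.erase i).filter (fun j => s j ≤ LinearMap.ker f)).card = 1 := by
      intro i
      rw [← Finset.sum_eq_sum_iff_of_le (hle1 i)]
      apply le_antisymm
      · simpa using hup i
      · have := hlow' i
        rw [hcard, show N + 2 - 1 = N + 1 by omega, ← hAN i] at this
        simpa using this
    have heven : ∀ f : Module.Dual F V, f ≠ 0 →
        Even (Finset.univ.filter (fun j => s j ≤ LinearMap.ker f)).card := by
      intro f hf
      rcases Finset.eq_empty_or_nonempty
        (Finset.univ.filter (fun j => s j ≤ LinearMap.ker f)) with h0 | ⟨i, hi⟩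
      · rw [h0]; simp
      · simp only [Finset.mem_filter, Finset.mem_univ, true_and] at hi
        have hfA : f ∈ A i := by simp [A, hf, hi]
        rw [← hsplit i f hfA, hex i f hfA]
        decide
    have hN3 : 3 ≤ N := by
      have : Odd N := hodd.pow
      rcases this with ⟨m, hm⟩
      omega
    -- a vector outside all the subspaces
    obtain ⟨x, hx⟩ : ∃ x : V, ∀ i, x ∉ s i := by
      by_contra! hc
      have h1 : (Finset.univ : Finset V) ⊆
          Finset.univ.biUnion (fun i => Finset.univ.filter (fun x => x ∈ s i)) := by
        intro x _
        simpa using hc x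
      have h2 := (Finset.card_le_card h1).trans (Finset.card_biUnion_le_card_mul _ _ N (by
        intro i _
        rw [← Fintype.card_subtype, Module.card_eq_pow_finrank (K := F) (V := s i), hd i]))
      rw [Finset.card_univ, Finset.card_univ, Module.card_eq_pow_finrank (K := F) (V := V), hV,
        hcard, ← hq, mul_comm 3 h, pow_mul, ← hNdef, pow_succ] at h2
      have h4 := Nat.le_of_mul_le_mul_right h2 (by omega)
      nlinarith
    have hdc2 : ∑ i, (Finset.univ.filter
          (fun f : Module.Dual F V => f x = 1 ∧ s i ≤ LinearMap.ker f)).card =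
        ∑ f ∈ Finset.univ.filter (fun f : Module.Dual F V => f x = 1),
          (Finset.univ.filter (fun j => s j ≤ LinearMap.ker f)).card := by
      have := Finset.sum_card_bipartiteAbove_eq_sum_card_bipartiteBelow
        (s := Finset.univ.filter (fun f : Module.Dual F V => f x = 1)) (t := Finset.univ)
        (fun f j => s j ≤ LinearMap.ker f)
      simp only [Finset.bipartiteAbove, Finset.bipartiteBelow, Finset.filter_filter] at this
      exact this.symm
    have he : Even (∑ f ∈ Finset.univ.filter (fun f : Module.Dual F V => f x = 1),
          (Finset.univ.filter (fun j => s j ≤ LinearMap.ker f)).card) := by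
      apply Finset.even_sum
      intro f hf
      apply heven
      rintro rfl
      simp at hf
    have ho : Odd (∑ i, (Finset.univ.filter
          (fun f : Module.Dual F V => f x = 1 ∧ s i ≤ LinearMap.ker f)).card) := by
      rw [Finset.odd_sum_iff_odd_card_odd, Finset.filter_true_of_mem, Finset.card_univ, hcard]
      · exact Odd.add_even hodd.pow (by decide)
      · intro i _
        exact odd_affine (s i) hodd x (hx i)
    rw [hdc2] at ho
    exact (Nat.not_even_iff_odd.2 ho) he

end Upper

section Lower

lemma lower_main {F K : Type*} [Field F] [Field K] [Algebra F K] (h : ℕ) (hh : 1 ≤ h)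
    [FiniteDimensional F K] (hK : Module.finrank F K = h) {ι : Type*} [Fintype ι]
    (v : ι → Fin 3 → K)
    (hv : ∀ i j k, i ≠ j → i ≠ k → j ≠ k → Matrix.det (Matrix.of ![v i, v j, v k]) ≠ 0) :
    ∃ S : Multiset (Submodule F (Fin (3 * h) → F)),
        Multiset.card S = Fintype.card ι ∧ (∀ W ∈ S, Module.finrank F W ≤ h) ∧
        ∀ H : Submodule F (Fin (3 * h) → F),
          Module.finrank F H = 3 * h - 1 → cnt S H ≤ 2 := by
  have e : (Fin 3 → K) ≃ₗ[F] (Fin (3 * h) → F) := by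
    apply LinearEquiv.ofFinrankEq
    simp [Module.finrank_pi_fintype, hK]
  let φ : ι → K →ₗ[F] (Fin (3 * h) → F) := fun i =>
    e.toLinearMap ∘ₗ ((LinearMap.toSpanSingleton K (Fin 3 → K) (v i)).restrictScalars F)
  have hφ : ∀ i a, φ i a = e (a • v i) := fun i a => rfl
  refine ⟨(Finset.univ : Finset ι).val.map (fun i => LinearMap.range (φ i)), ?_, ?_, ?_⟩
  · simp
  · intro W hW
    simp only [Multiset.mem_map] at hW
    obtain ⟨i, _, rfl⟩ := hW
    exact hK ▸ LinearMap.finrank_range_le (φ i)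
  · intro H hH
    by_contra! hc
    unfold cnt at hc
    rw [Multiset.countP_map, ← Finset.filter_val, Finset.card_val, Finset.two_lt_card] at hc
    obtain ⟨i, hi, j, hj, k, hk, hij, hik, hjk⟩ := hc
    simp only [Finset.mem_filter, Finset.mem_univ, true_and] at hi hj hk
    have htop : H = ⊤ := by
      rw [eq_top_iff]
      intro y _
      set M : Matrix (Fin 3) (Fin 3) K := Matrix.of ![v i, v j, v k] with hM
      have hdet : IsUnit M.det := isUnit_iff_ne_zero.2 (hv i j k hij hik hjk)
      set z := e.symm y with hz
      set c := Matrix.vecMul z M⁻¹ with hcdef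
      have hcz : Matrix.vecMul c M = z := by
        rw [hcdef, Matrix.vecMul_vecMul, Matrix.nonsing_inv_mul _ hdet, Matrix.vecMul_one]
      have hsum : z = c 0 • v i + c 1 • v j + c 2 • v k := by
        rw [← hcz]
        ext t
        simp [Matrix.vecMul, dotProduct, Fin.sum_univ_three, hM]
      have hy : y = φ i (c 0) + φ j (c 1) + φ k (c 2) := by
        rw [hφ, hφ, hφ, ← map_add, ← map_add, ← hsum, hz, e.apply_symm_apply]
      rw [hy]
      exact H.add_mem (H.add_mem (hi ⟨_, rfl⟩) (hj ⟨_, rfl⟩)) (hk ⟨_, rfl⟩)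
    rw [htop, finrank_top] at hH
    simp at hH
    omega

/-- The points of the conic. -/
def conicPt {K : Type*} [Field K] : Option K → Fin 3 → K
  | none => ![0, 0, 1]
  | some t => ![1, t, t ^ 2]

/-- The points of the conic together with its nucleus. -/
def hyperovalPt {K : Type*} [Field K] : Option (Option K) → Fin 3 → K
  | none => ![0, 1, 0]
  | some p => conicPt p

lemma conic_det {K : Type*} [Field K] (i j k : Option K) (hij : i ≠ j) (hik : i ≠ k)
    (hjk : j ≠ k) : Matrix.det (Matrix.of ![conicPt i, conicPt j, conicPt k]) ≠ 0 := by
  rw [Matrix.det_fin_three]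
  rcases i with _ | a <;> rcases j with _ | b <;> rcases k with _ | c <;>
    simp_all [conicPt]
  · exact fun h => hjk (by linear_combination -h)
  · exact fun h => hik (by linear_combination h)
  · exact fun h => hij (by linear_combination -h)
  · intro h
    have : (a - b) * ((a - c) * (b - c)) = 0 := by linear_combination -h
    simp only [mul_eq_zero, sub_eq_zero] at this
    tauto

lemma sq_inj_char_two {K : Type*} [Field K] [CharP K 2] (a b : K) (h : a ^ 2 = b ^ 2) : a = b := by
  have h2 : (2 : K) = 0 := CharP.cast_eq_zero K 2
  have : (a - b) ^ 2 = 0 := by linear_combination h + (b ^ 2 - a * b) * h2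
  exact sub_eq_zero.1 ((pow_eq_zero_iff two_ne_zero).1 this)

lemma hyperoval_det {K : Type*} [Field K] [CharP K 2] (i j k : Option (Option K))
    (hij : i ≠ j) (hik : i ≠ k) (hjk : j ≠ k) :
    Matrix.det (Matrix.of ![hyperovalPt i, hyperovalPt j, hyperovalPt k]) ≠ 0 := by
  rcases i with _ | i <;> rcases j with _ | j <;> rcases k with _ | k
  case some.some.some =>
    exact conic_det i j k (by simpa using hij) (by simpa using hik) (by simpa using hjk)
  all_goals first
    | exact absurd rfl hij
    | exact absurd rfl hik
    | exact absurd rfl hjk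
    | skip
  all_goals rw [Matrix.det_fin_three]
  · rcases j with _ | b <;> rcases k with _ | c <;> simp_all [conicPt, hyperovalPt]
    exact fun h => hjk (sq_inj_char_two _ _ (by linear_combination h))
  · rcases i with _ | b <;> rcases k with _ | c <;> simp_all [conicPt, hyperovalPt]
    exact fun h => hik (sq_inj_char_two _ _ (by linear_combination -h))
  · rcases i with _ | b <;> rcases j with _ | c <;> simp_all [conicPt, hyperovalPt]
    exact fun h => hij (sq_inj_char_two _ _ (by linear_combination h))

lemma exists_ext (F : Type*) [Field F] [Fintype F] (h : ℕ) (hh : 1 ≤ h) :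
    ∃ (K : Type) (_ : Field K) (_ : Fintype K) (_ : Algebra F K),
      Module.finrank F K = h ∧ Fintype.card K = Fintype.card F ^ h := by
  obtain ⟨p, hp⟩ := CharP.exists F
  have : Fact p.Prime := ⟨CharP.char_is_prime F p⟩
  have : NeZero h := ⟨by omega⟩
  refine ⟨FiniteField.Extension F p h, inferInstance, Fintype.ofFinite _, inferInstance,
    FiniteField.finrank_extension F p h, ?_⟩
  have := FiniteField.natCard_extension F p h
  rwa [Nat.card_eq_fintype_card (α := F), @Nat.card_eq_fintype_card _ (Fintype.ofFinite _)] at this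

end Lower

lemma upper_multiset (F : Type*) [Field F] [Fintype F] (h : ℕ) (hh : 1 ≤ h)
    (S : Multiset (Submodule F (Fin (3 * h) → F)))
    (hS : ∀ W ∈ S, Module.finrank F W ≤ h)
    (hH : ∀ H : Submodule F (Fin (3 * h) → F),
          Module.finrank F H = 3 * h - 1 → cnt S H ≤ 2) :
    Multiset.card S ≤ Fintype.card F ^ h + 2 ∧
    (Odd (Fintype.card F) → Multiset.card S ≠ Fintype.card F ^ h + 2) := by
  obtain ⟨l, rfl⟩ : ∃ l : List (Submodule F (Fin (3 * h) → F)), (l : Multiset _) = S :=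
    ⟨S.toList, S.coe_toList⟩
  have hl : (l : Multiset (Submodule F (Fin (3 * h) → F))) =
      (Finset.univ : Finset (Fin l.length)).val.map l.get := by
    rw [Fin.univ_val_map, List.ofFn_get]
  have := upper_main (F := F) (V := Fin (3 * h) → F) l.get h hh (by simp)
    (fun i => hS _ (by simp)) (by
      intro f hf
      have h1 := Module.Dual.finrank_ker_add_one_of_ne_zero hf
      have h2 := hH (LinearMap.ker f) (by simp at h1; omega)
      unfold cnt at h2
      rwa [hl, Multiset.countP_map, ← Finset.filter_val, Finset.card_val] at h2)
  simpa using this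

theorem statement18 (F : Type*) [Field F] [Fintype F] (q h : ℕ)
    (hq : q = Fintype.card F) (hh : 1 ≤ h) :
    (Odd q →
      IsGreatest {n : ℕ | ∃ S : Multiset (Submodule F (Fin (3 * h) → F)),
        Multiset.card S = n ∧ (∀ W ∈ S, Module.finrank F W ≤ h) ∧
        ∀ H : Submodule F (Fin (3 * h) → F),
          Module.finrank F H = 3 * h - 1 → cnt S H ≤ 2} (q ^ h + 1)) ∧
    (Even q →
      IsGreatest {n : ℕ | ∃ S : Multiset (Submodule F (Fin (3 * h) → F)),
        Multiset.card S = n ∧ (∀ W ∈ S, Module.finrank F W ≤ h) ∧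
        ∀ H : Submodule F (Fin (3 * h) → F),
          Module.finrank F H = 3 * h - 1 → cnt S H ≤ 2} (q ^ h + 2)) := by
  subst hq
  obtain ⟨K, _, _, _, hK, hcK⟩ := exists_ext F h hh
  have : FiniteDimensional F K := FiniteDimensional.of_finrank_pos (by omega)
  constructor
  · intro hodd
    refine ⟨?_, ?_⟩
    · have := lower_main (F := F) h hh hK (conicPt (K := K)) conic_det
      rwa [Fintype.card_option, hcK] at this
    · rintro n ⟨S, rfl, hS, hH⟩
      have h1 := upper_multiset F h hh S hS hH
      have h2 := h1.2 hodd
      have h3 := h1.1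
      omega
  · intro heven
    refine ⟨?_, ?_⟩
    · have hF2 : ringChar F = 2 := FiniteField.even_card_iff_char_two.2 (Nat.even_iff.1 heven)
      have : CharP F 2 := hF2 ▸ ringChar.charP F
      have : CharP K 2 := charP_of_injective_algebraMap (algebraMap F K).injective 2
      have := lower_main (F := F) h hh hK (hyperovalPt (K := K)) hyperoval_det
      rwa [Fintype.card_option, Fintype.card_option, hcK] at this
    · rintro n ⟨S, rfl, hS, hH⟩
      exact (upper_multiset F h hh S hS hH).1
end
end
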